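/- arXiv:1304.3280 — 7 statements merged into one kernel-verified Lean document; each statement's English description precedes it below -/
import Mathlib

section
/- For every fixed strictly positive conditional pmf Q(t|y,s₂,v₂), the functional J_w(·,Q) is maximized over conditional pmfs q(t|s₁,v₂) at q* defined by q*(t|s₁,v₂) = ∏_{s₂,y} Q(t|y,s₂,v₂)^{p(s₂|s₁,v₂)·p(y|t,s₁,s₂,v₂)} / Σ_{t'} ∏_{s₂,y} Q(t'|y,s₂,v₂)^{p(s₂|s₁,v₂)·p(y|t',s₁,s₂,v₂)}: for every conditional pmf q, J_w(q,Q) ≤ J_w(q*,Q). -/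
open scoped Classical

/-- The joint pmf `p(s₁,s₂,v₂,t,y) = p(s₁,s₂) w(v₂|s₂) q(t|s₁,v₂) p(y|t,s₁,s₂,v₂)`. -/
noncomputable def jointW {S1 S2 V2 T Y : Type*}
    (p : S1 → S2 → ℝ) (w : S2 → V2 → ℝ) (ch : T → S1 → S2 → V2 → Y → ℝ)
    (q : S1 → V2 → T → ℝ) (s1 : S1) (s2 : S2) (v2 : V2) (t : T) (y : Y) : ℝ :=
  p s1 s2 * w s2 v2 * q s1 v2 t * ch t s1 s2 v2 y

/-- `J_w(q,Q) = Σ p(s₁,s₂,v₂,t,y) log( Q(t|y,s₂,v₂) / q(t|s₁,v₂) )` (summands with zero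
joint probability vanish since they are multiplied by `0`). -/
noncomputable def Jw {S1 S2 V2 T Y : Type*}
    [Fintype S1] [Fintype S2] [Fintype V2] [Fintype T] [Fintype Y]
    (p : S1 → S2 → ℝ) (w : S2 → V2 → ℝ) (ch : T → S1 → S2 → V2 → Y → ℝ)
    (q : S1 → V2 → T → ℝ) (Q : Y → S2 → V2 → T → ℝ) : ℝ :=
  ∑ s1, ∑ s2, ∑ v2, ∑ t, ∑ y,
    jointW p w ch q s1 s2 v2 t y * Real.log (Q y s2 v2 t / q s1 v2 t)

/-- The conditional pmf `p(s₂|s₁,v₂) = p(s₁,s₂) w(v₂|s₂) / Σ_{s₂'} p(s₁,s₂') w(v₂|s₂')`. -/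
noncomputable def pS2cond {S1 S2 V2 : Type*} [Fintype S2]
    (p : S1 → S2 → ℝ) (w : S2 → V2 → ℝ) (s1 : S1) (v2 : V2) (s2 : S2) : ℝ :=
  p s1 s2 * w s2 v2 / ∑ s2', p s1 s2' * w s2' v2

/-- The maximizer `q*(t|s₁,v₂)` of `J_w(·,Q)`:
`q*(t|s₁,v₂) = Π_{s₂,y} Q(t|y,s₂,v₂)^{p(s₂|s₁,v₂) p(y|t,s₁,s₂,v₂)} / (normalization)`. -/
noncomputable def qStar {S1 S2 V2 T Y : Type*}
    [Fintype S2] [Fintype T] [Fintype Y]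
    (p : S1 → S2 → ℝ) (w : S2 → V2 → ℝ) (ch : T → S1 → S2 → V2 → Y → ℝ)
    (Q : Y → S2 → V2 → T → ℝ) (s1 : S1) (v2 : V2) (t : T) : ℝ :=
  (∏ s2, ∏ y, Q y s2 v2 t ^ (pS2cond p w s1 v2 s2 * ch t s1 s2 v2 y)) /
    ∑ t', ∏ s2, ∏ y, Q y s2 v2 t' ^ (pS2cond p w s1 v2 s2 * ch t' s1 s2 v2 y)

/-- The unnormalized maximizer `Π_{s₂,y} Q(t|y,s₂,v₂)^{p(s₂|s₁,v₂) p(y|t,s₁,s₂,v₂)}`. -/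
noncomputable def qStarNumerator {S1 S2 V2 T Y : Type*} [Fintype S2] [Fintype Y]
    (p : S1 → S2 → ℝ) (w : S2 → V2 → ℝ) (ch : T → S1 → S2 → V2 → Y → ℝ)
    (Q : Y → S2 → V2 → T → ℝ) (s1 : S1) (v2 : V2) (t : T) : ℝ :=
  ∏ s2, ∏ y, Q y s2 v2 t ^ (pS2cond p w s1 v2 s2 * ch t s1 s2 v2 y)

theorem qStarNumerator_pos {S1 S2 V2 T Y : Type*} [Fintype S2] [Fintype Y]
    (p : S1 → S2 → ℝ) (w : S2 → V2 → ℝ) (ch : T → S1 → S2 → V2 → Y → ℝ)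
    {Q : Y → S2 → V2 → T → ℝ} (hQpos : ∀ y s2 v2 t, 0 < Q y s2 v2 t)
    (s1 : S1) (v2 : V2) (t : T) : 0 < qStarNumerator p w ch Q s1 v2 t :=
  Finset.prod_pos fun _ _ => Finset.prod_pos fun _ _ => Real.rpow_pos_of_pos (hQpos _ _ _ _) _

theorem log_qStarNumerator {S1 S2 V2 T Y : Type*} [Fintype S2] [Fintype Y]
    (p : S1 → S2 → ℝ) (w : S2 → V2 → ℝ) (ch : T → S1 → S2 → V2 → Y → ℝ)
    {Q : Y → S2 → V2 → T → ℝ} (hQpos : ∀ y s2 v2 t, 0 < Q y s2 v2 t)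
    (s1 : S1) (v2 : V2) (t : T) :
    Real.log (qStarNumerator p w ch Q s1 v2 t) =
      ∑ s2, ∑ y, pS2cond p w s1 v2 s2 * ch t s1 s2 v2 y * Real.log (Q y s2 v2 t) := by
  have hpow : ∀ s2 y, 0 < Q y s2 v2 t ^ (pS2cond p w s1 v2 s2 * ch t s1 s2 v2 y) :=
    fun s2 y => Real.rpow_pos_of_pos (hQpos y s2 v2 t) _
  rw [qStarNumerator, Real.log_prod fun s2 _ => (Finset.prod_pos fun y _ => hpow s2 y).ne']
  refine Finset.sum_congr rfl fun s2 _ => ?_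
  rw [Real.log_prod fun y _ => (hpow s2 y).ne']
  exact Finset.sum_congr rfl fun y _ => Real.log_rpow (hQpos y s2 v2 t) _

theorem sum_pS2cond {S1 S2 V2 : Type*} [Fintype S2] {p : S1 → S2 → ℝ} {w : S2 → V2 → ℝ}
    {s1 : S1} {v2 : V2} (hpos : 0 < ∑ s2', p s1 s2' * w s2' v2) :
    ∑ s2, pS2cond p w s1 v2 s2 = 1 := by
  simp only [pS2cond, ← Finset.sum_div]
  exact div_self hpos.ne'

/-- `J_w` as an average over `(s₁,v₂)` of one free-energy functional of `q(·|s₁,v₂)` each. -/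
theorem Jw_eq_sum_log_qStarNumerator_sub_log {S1 S2 V2 T Y : Type*}
    [Fintype S1] [Fintype S2] [Fintype V2] [Fintype T] [Fintype Y]
    {p : S1 → S2 → ℝ} {w : S2 → V2 → ℝ} (hpos : ∀ s1 v2, 0 < ∑ s2', p s1 s2' * w s2' v2)
    {ch : T → S1 → S2 → V2 → Y → ℝ} (hch1 : ∀ t s1 s2 v2, ∑ y, ch t s1 s2 v2 y = 1)
    {Q : Y → S2 → V2 → T → ℝ} (hQpos : ∀ y s2 v2 t, 0 < Q y s2 v2 t) (q : S1 → V2 → T → ℝ) :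
    Jw p w ch q Q = ∑ s1, ∑ v2, (∑ s2', p s1 s2' * w s2' v2) *
      ∑ t, q s1 v2 t * (Real.log (qStarNumerator p w ch Q s1 v2 t) - Real.log (q s1 v2 t)) := by
  refine Finset.sum_congr rfl fun s1 _ => ?_
  rw [Finset.sum_comm]
  refine Finset.sum_congr rfl fun v2 _ => ?_
  rw [Finset.sum_comm, Finset.mul_sum]
  refine Finset.sum_congr rfl fun t _ => ?_
  have hlog : Real.log (q s1 v2 t) =
      ∑ s2, ∑ y, pS2cond p w s1 v2 s2 * ch t s1 s2 v2 y * Real.log (q s1 v2 t) := by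
    simp_rw [← Finset.sum_mul, ← Finset.mul_sum, hch1, mul_one, sum_pS2cond (hpos s1 v2), one_mul]
  rw [log_qStarNumerator p w ch hQpos, hlog]
  simp_rw [← Finset.sum_sub_distrib, Finset.mul_sum]
  refine Finset.sum_congr rfl fun s2 _ => Finset.sum_congr rfl fun y _ => ?_
  have hcond : p s1 s2 * w s2 v2 =
      (∑ s2', p s1 s2' * w s2' v2) * pS2cond p w s1 v2 s2 :=
    (mul_div_cancel₀ _ (hpos s1 v2).ne').symm
  by_cases hq : q s1 v2 t = 0
  · simp [jointW, hq]
  · rw [jointW, hcond, Real.log_div (hQpos y s2 v2 t).ne' hq]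
    ring

theorem mul_log_sub_log_le_sub {a b : ℝ} (ha : 0 ≤ a) (hb : 0 < b) :
    a * (Real.log b - Real.log a) ≤ b - a := by
  rcases ha.eq_or_lt with rfl | ha
  · simpa using hb.le
  · rw [← Real.log_div hb.ne' ha.ne']
    calc a * Real.log (b / a) ≤ a * (b / a - 1) :=
          mul_le_mul_of_nonneg_left (Real.log_le_sub_one_of_pos (div_pos hb ha)) ha.le
      _ = b - a := by field_simp

/-- The Gibbs variational principle on a finite type. -/
theorem sum_mul_log_sub_log_le_gibbs {T : Type*} [Fintype T] [Nonempty T] {a q : T → ℝ}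
    (ha : ∀ t, 0 < a t) (hq0 : ∀ t, 0 ≤ q t) (hq1 : ∑ t, q t = 1) :
    ∑ t, q t * (Real.log (a t) - Real.log (q t)) ≤
      ∑ t, a t / (∑ t', a t') * (Real.log (a t) - Real.log (a t / ∑ t', a t')) := by
  have hZ : 0 < ∑ t', a t' := Finset.sum_pos (fun t _ => ha t) Finset.univ_nonempty
  have hg1 : ∑ t, a t / (∑ t', a t') = 1 := by rw [← Finset.sum_div, div_self hZ.ne']
  have hlog : ∀ t, Real.log (a t / ∑ t', a t') = Real.log (a t) - Real.log (∑ t', a t') :=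
    fun t => Real.log_div (ha t).ne' hZ.ne'
  have hle : ∑ t, q t * (Real.log (a t / ∑ t', a t') - Real.log (q t)) ≤ 0 :=
    calc ∑ t, q t * (Real.log (a t / ∑ t', a t') - Real.log (q t))
        ≤ ∑ t, (a t / (∑ t', a t') - q t) :=
          Finset.sum_le_sum fun t _ => mul_log_sub_log_le_sub (hq0 t) (div_pos (ha t) hZ)
      _ = 0 := by rw [Finset.sum_sub_distrib, hg1, hq1, sub_self]
  calc ∑ t, q t * (Real.log (a t) - Real.log (q t))
      = ∑ t, q t * (Real.log (a t / ∑ t', a t') - Real.log (q t)) +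
          (∑ t, q t) * Real.log (∑ t', a t') := by
        rw [Finset.sum_mul, ← Finset.sum_add_distrib]
        refine Finset.sum_congr rfl fun t _ => ?_
        rw [hlog]
        ring
    _ ≤ Real.log (∑ t', a t') := by rw [hq1, one_mul]; linarith
    _ = ∑ t, a t / (∑ t', a t') * (Real.log (a t) - Real.log (a t / ∑ t', a t')) := by
        simp_rw [hlog, sub_sub_cancel]
        rw [← Finset.sum_mul, hg1, one_mul]

/-- for a fixed strictly positive conditional pmf `Q`, the functional
`J_w(·,Q)` is maximized over conditional pmfs `q(t|s₁,v₂)` at `q*`. -/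
theorem Jw_le_Jw_qStar {S1 S2 V2 T Y : Type*}
    [Fintype S1] [Fintype S2] [Fintype V2] [Fintype T] [Fintype Y]
    [Nonempty S1] [Nonempty S2] [Nonempty V2] [Nonempty T] [Nonempty Y]
    (p : S1 → S2 → ℝ) (hp0 : ∀ s1 s2, 0 ≤ p s1 s2) (hp1 : ∑ s1, ∑ s2, p s1 s2 = 1)
    (w : S2 → V2 → ℝ) (hw0 : ∀ s2 v2, 0 ≤ w s2 v2) (hw1 : ∀ s2, ∑ v2, w s2 v2 = 1)
    (hpos : ∀ s1 v2, 0 < ∑ s2', p s1 s2' * w s2' v2)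
    (ch : T → S1 → S2 → V2 → Y → ℝ)
    (hch0 : ∀ t s1 s2 v2 y, 0 ≤ ch t s1 s2 v2 y)
    (hch1 : ∀ t s1 s2 v2, ∑ y, ch t s1 s2 v2 y = 1)
    (Q : Y → S2 → V2 → T → ℝ)
    (hQpos : ∀ y s2 v2 t, 0 < Q y s2 v2 t) (hQ1 : ∀ y s2 v2, ∑ t, Q y s2 v2 t = 1) :
    ∀ q : S1 → V2 → T → ℝ,
      (∀ s1 v2 t, 0 ≤ q s1 v2 t) → (∀ s1 v2, ∑ t, q s1 v2 t = 1) →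
      Jw p w ch q Q ≤ Jw p w ch (qStar p w ch Q) Q := by
  intro q hq0 hq1
  rw [Jw_eq_sum_log_qStarNumerator_sub_log hpos hch1 hQpos,
    Jw_eq_sum_log_qStarNumerator_sub_log hpos hch1 hQpos]
  refine Finset.sum_le_sum fun s1 _ => Finset.sum_le_sum fun v2 _ =>
    mul_le_mul_of_nonneg_left ?_ (hpos s1 v2).le
  exact sum_mul_log_sub_log_le_gibbs (qStarNumerator_pos p w ch hQpos s1 v2)
    (hq0 s1 v2) (hq1 s1 v2)
end

section
/- For any two strictly positive conditional pmfs q₀(t|s₁,v₂) and q₁(t|s₁,v₂), one has J_w(q₀, Q*_{q₀}) ≤ U_w(q₁), where U_w(q) = Σ_{s₁,v₂} p(s₁,v₂) · max_t Σ_{s₂,y} p(s₂|s₁,v₂) p(y|t,s₁,s₂,v₂) log( Q*_q(t|y,s₂,v₂) / q(t|s₁,v₂) ). Consequently U_w(q) is an upper bound, for every strictly positive conditional pmf q, on the supremum of J_w(q₀,Q*_{q₀}) over all strictly positive conditional pmfs q₀. -/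
open scoped Classical

/-- The hypothesis that `Q` is a version of the induced conditional marginal `Q*_q`:
it equals `Σ_{s₁} p(s₁,s₂,v₂,t,y) / Σ_{s₁,t'} p(s₁,s₂,v₂,t',y)` wherever the
denominator is positive. -/
def IsMarginalOf {S1 S2 V2 T Y : Type*}
    [Fintype S1] [Fintype T]
    (p : S1 → S2 → ℝ) (w : S2 → V2 → ℝ) (ch : T → S1 → S2 → V2 → Y → ℝ)
    (q : S1 → V2 → T → ℝ) (Q : Y → S2 → V2 → T → ℝ) : Prop :=
  ∀ y s2 v2, 0 < ∑ s1, ∑ t', jointW p w ch q s1 s2 v2 t' y →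
    ∀ t, Q y s2 v2 t =
      (∑ s1, jointW p w ch q s1 s2 v2 t y) / (∑ s1, ∑ t', jointW p w ch q s1 s2 v2 t' y)

/-- `U_w(q) = Σ_{s₁,v₂} p(s₁,v₂) max_t Σ_{s₂,y} p(s₂|s₁,v₂) p(y|t,s₁,s₂,v₂)
log( Q*_q(t|y,s₂,v₂) / q(t|s₁,v₂) )`, where `Q` is the induced conditional marginal. -/
noncomputable def Uw {S1 S2 V2 T Y : Type*}
    [Fintype S1] [Fintype S2] [Fintype V2] [Fintype T] [Fintype Y] [Nonempty T]
    (p : S1 → S2 → ℝ) (w : S2 → V2 → ℝ) (ch : T → S1 → S2 → V2 → Y → ℝ)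
    (q : S1 → V2 → T → ℝ) (Q : Y → S2 → V2 → T → ℝ) : ℝ :=
  ∑ s1, ∑ v2, (∑ s2, p s1 s2 * w s2 v2) *
    (Finset.univ.sup' Finset.univ_nonempty fun t =>
      ∑ s2, ∑ y, (p s1 s2 * w s2 v2 / ∑ s2', p s1 s2' * w s2' v2) * ch t s1 s2 v2 y *
        Real.log (Q y s2 v2 t / q s1 v2 t))

section MarginalBounds

variable {S1 S2 V2 T Y : Type*}
  {p : S1 → S2 → ℝ} {w : S2 → V2 → ℝ} {ch : T → S1 → S2 → V2 → Y → ℝ}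
  {q q' : S1 → V2 → T → ℝ} {Q Q' : Y → S2 → V2 → T → ℝ}

theorem jointW_nonneg (hp : ∀ s1 s2, 0 ≤ p s1 s2) (hw : ∀ s2 v2, 0 ≤ w s2 v2)
    (hch : ∀ t s1 s2 v2 y, 0 < ch t s1 s2 v2 y) (hq : ∀ s1 v2 t, 0 < q s1 v2 t)
    (s1 : S1) (s2 : S2) (v2 : V2) (t : T) (y : Y) : 0 ≤ jointW p w ch q s1 s2 v2 t y :=
  mul_nonneg (mul_nonneg (mul_nonneg (hp _ _) (hw _ _)) (hq _ _ _).le) (hch _ _ _ _ _).le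

variable [Fintype S1] [Fintype T]

theorem IsMarginalOf.sum_jointW_eq (hQ : IsMarginalOf p w ch q Q)
    (hp : ∀ s1 s2, 0 ≤ p s1 s2) (hw : ∀ s2 v2, 0 ≤ w s2 v2)
    (hch : ∀ t s1 s2 v2 y, 0 < ch t s1 s2 v2 y) (hq : ∀ s1 v2 t, 0 < q s1 v2 t)
    (s2 : S2) (v2 : V2) (t : T) (y : Y) :
    ∑ s1, jointW p w ch q s1 s2 v2 t y =
      Q y s2 v2 t * ∑ s1, ∑ t', jointW p w ch q s1 s2 v2 t' y := by
  have hJ := jointW_nonneg hp hw hch hq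
  have hD : 0 ≤ ∑ s1, ∑ t', jointW p w ch q s1 s2 v2 t' y :=
    Finset.sum_nonneg fun s1 _ => Finset.sum_nonneg fun t' _ => hJ s1 s2 v2 t' y
  rcases hD.lt_or_eq with h | h
  · rw [hQ y s2 v2 h t, div_mul_cancel₀ _ h.ne']
  · rw [← h, mul_zero]
    refine le_antisymm (h ▸ Finset.sum_le_sum fun s1 _ => ?_) (Finset.sum_nonneg fun s1 _ => hJ ..)
    exact Finset.single_le_sum (f := fun t' => jointW p w ch q s1 s2 v2 t' y)
      (fun t' _ => hJ s1 s2 v2 t' y) (Finset.mem_univ t)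

theorem IsMarginalOf.pos_of_mul_pos (hQ : IsMarginalOf p w ch q Q)
    (hQ0 : ∀ y s2 v2 t, 0 ≤ Q y s2 v2 t)
    (hp : ∀ s1 s2, 0 ≤ p s1 s2) (hw : ∀ s2 v2, 0 ≤ w s2 v2)
    (hch : ∀ t s1 s2 v2 y, 0 < ch t s1 s2 v2 y) (hq : ∀ s1 v2 t, 0 < q s1 v2 t)
    {s1 : S1} {s2 : S2} {v2 : V2} (h : 0 < p s1 s2 * w s2 v2) (t : T) (y : Y) :
    0 < Q y s2 v2 t := by
  refine (hQ0 y s2 v2 t).lt_of_ne' fun hz => ?_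
  have hsum := hQ.sum_jointW_eq hp hw hch hq s2 v2 t y
  rw [hz, zero_mul] at hsum
  have hle := Finset.single_le_sum (f := fun s1 => jointW p w ch q s1 s2 v2 t y)
    (fun s1 _ => jointW_nonneg hp hw hch hq s1 s2 v2 t y) (Finset.mem_univ s1)
  have hpos : 0 < jointW p w ch q s1 s2 v2 t y := mul_pos (mul_pos h (hq _ _ _)) (hch _ _ _ _ _)
  exact absurd (hsum ▸ hle) hpos.not_ge

theorem jointW_mul_log_le (hQ : IsMarginalOf p w ch q Q) (hQ0 : ∀ y s2 v2 t, 0 ≤ Q y s2 v2 t)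
    (hQ' : IsMarginalOf p w ch q' Q') (hQ0' : ∀ y s2 v2 t, 0 ≤ Q' y s2 v2 t)
    (hp : ∀ s1 s2, 0 ≤ p s1 s2) (hw : ∀ s2 v2, 0 ≤ w s2 v2)
    (hch : ∀ t s1 s2 v2 y, 0 < ch t s1 s2 v2 y)
    (hq : ∀ s1 v2 t, 0 < q s1 v2 t) (hq' : ∀ s1 v2 t, 0 < q' s1 v2 t)
    (s1 : S1) (s2 : S2) (v2 : V2) (t : T) (y : Y) :
    jointW p w ch q s1 s2 v2 t y * Real.log (Q y s2 v2 t / q s1 v2 t) ≤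
      jointW p w ch q s1 s2 v2 t y * Real.log (Q' y s2 v2 t / q' s1 v2 t) +
        (jointW p w ch q' s1 s2 v2 t y * (Q y s2 v2 t / Q' y s2 v2 t) -
          jointW p w ch q s1 s2 v2 t y) := by
  rcases (mul_nonneg (hp s1 s2) (hw s2 v2)).lt_or_eq with h | h
  · have hQpos := hQ.pos_of_mul_pos hQ0 hp hw hch hq h t y
    have hQpos' := hQ'.pos_of_mul_pos hQ0' hp hw hch hq' h t y
    have hqt := hq s1 v2 t
    have hqt' := hq' s1 v2 t
    have hJ := jointW_nonneg hp hw hch hq s1 s2 v2 t y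
    have hlog := Real.log_le_sub_one_of_pos
      (div_pos (div_pos hQpos hqt) (div_pos hQpos' hqt'))
    rw [Real.log_div (div_pos hQpos hqt).ne' (div_pos hQpos' hqt').ne'] at hlog
    have hswap : jointW p w ch q' s1 s2 v2 t y * (Q y s2 v2 t / Q' y s2 v2 t) =
        jointW p w ch q s1 s2 v2 t y *
          (Q y s2 v2 t / q s1 v2 t / (Q' y s2 v2 t / q' s1 v2 t)) := by
      unfold jointW
      field_simp
    rw [hswap]
    nlinarith [mul_le_mul_of_nonneg_left hlog hJ]
  · simp [jointW, ← h]

variable [Fintype S2] [Fintype V2] [Fintype Y]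

theorem sum_jointW_eq_one (hp1 : ∑ s1, ∑ s2, p s1 s2 = 1) (hw1 : ∀ s2, ∑ v2, w s2 v2 = 1)
    (hch1 : ∀ t s1 s2 v2, ∑ y, ch t s1 s2 v2 y = 1) (hq1 : ∀ s1 v2, ∑ t, q s1 v2 t = 1) :
    ∑ s1, ∑ s2, ∑ v2, ∑ t, ∑ y, jointW p w ch q s1 s2 v2 t y = 1 := by
  simp only [jointW, ← Finset.mul_sum, hch1, hq1, hw1, mul_one, hp1]

theorem sum_jointW_mul_div_le_one (hQ1 : ∀ y s2 v2, ∑ t, Q y s2 v2 t = 1)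
    (hQ0 : ∀ y s2 v2 t, 0 ≤ Q y s2 v2 t) (hQ' : IsMarginalOf p w ch q' Q')
    (hp : ∀ s1 s2, 0 ≤ p s1 s2) (hp1 : ∑ s1, ∑ s2, p s1 s2 = 1)
    (hw : ∀ s2 v2, 0 ≤ w s2 v2) (hw1 : ∀ s2, ∑ v2, w s2 v2 = 1)
    (hch : ∀ t s1 s2 v2 y, 0 < ch t s1 s2 v2 y)
    (hch1 : ∀ t s1 s2 v2, ∑ y, ch t s1 s2 v2 y = 1)
    (hq' : ∀ s1 v2 t, 0 < q' s1 v2 t) (hq1' : ∀ s1 v2, ∑ t, q' s1 v2 t = 1) :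
    ∑ s1, ∑ s2, ∑ v2, ∑ t, ∑ y,
      jointW p w ch q' s1 s2 v2 t y * (Q y s2 v2 t / Q' y s2 v2 t) ≤ 1 := by
  have hreorder (f : S1 → S2 → V2 → T → Y → ℝ) : ∑ s1, ∑ s2, ∑ v2, ∑ t, ∑ y, f s1 s2 v2 t y =
      ∑ s2, ∑ v2, ∑ y, ∑ t, ∑ s1, f s1 s2 v2 t y := by
    rw [Finset.sum_comm]
    refine Finset.sum_congr rfl fun s2 _ => ?_
    rw [Finset.sum_comm]
    refine Finset.sum_congr rfl fun v2 _ => ?_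
    rw [Finset.sum_comm, Finset.sum_comm (γ := Y)]
    exact Finset.sum_congr rfl fun t _ => Finset.sum_comm
  rw [← sum_jointW_eq_one hp1 hw1 hch1 hq1', hreorder, hreorder]
  refine Finset.sum_le_sum fun s2 _ => Finset.sum_le_sum fun v2 _ =>
    Finset.sum_le_sum fun y _ => ?_
  set D := ∑ s1, ∑ t', jointW p w ch q' s1 s2 v2 t' y with hD
  have hD0 : 0 ≤ D := Finset.sum_nonneg fun s1 _ => Finset.sum_nonneg fun t' _ =>
    jointW_nonneg hp hw hch hq' s1 s2 v2 t' y
  calc ∑ t, ∑ s1, jointW p w ch q' s1 s2 v2 t y * (Q y s2 v2 t / Q' y s2 v2 t)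
      ≤ ∑ t, Q y s2 v2 t * D := by
        gcongr with t _
        rw [← Finset.sum_mul, hQ'.sum_jointW_eq hp hw hch hq', ← hD]
        rcases eq_or_ne (Q' y s2 v2 t) 0 with h | h
        · simpa [h] using mul_nonneg (hQ0 y s2 v2 t) hD0
        · exact le_of_eq (by field_simp)
    _ = ∑ t, ∑ s1, jointW p w ch q' s1 s2 v2 t y := by
        rw [← Finset.sum_mul, hQ1, one_mul, hD, Finset.sum_comm]

theorem sum_jointW_mul_log_le_Uw [Nonempty T]
    (hpos : ∀ s1 v2, 0 < ∑ s2', p s1 s2' * w s2' v2)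
    (hq : ∀ s1 v2 t, 0 < q s1 v2 t) (hq1 : ∀ s1 v2, ∑ t, q s1 v2 t = 1) :
    ∑ s1, ∑ s2, ∑ v2, ∑ t, ∑ y,
      jointW p w ch q s1 s2 v2 t y * Real.log (Q' y s2 v2 t / q' s1 v2 t) ≤
        Uw p w ch q' Q' := by
  unfold Uw
  gcongr with s1 _
  rw [Finset.sum_comm]
  gcongr with v2 _
  rw [Finset.sum_comm]
  set P := ∑ s2, p s1 s2 * w s2 v2 with hP
  have hP0 : 0 < P := hpos s1 v2
  set F : T → ℝ := fun t => ∑ s2, ∑ y, (p s1 s2 * w s2 v2 / P) * ch t s1 s2 v2 y *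
    Real.log (Q' y s2 v2 t / q' s1 v2 t) with hF
  calc ∑ t, ∑ s2, ∑ y, jointW p w ch q s1 s2 v2 t y * Real.log (Q' y s2 v2 t / q' s1 v2 t)
      = ∑ t, q s1 v2 t * (P * F t) := by
        simp only [hF, Finset.mul_sum, jointW]
        refine Finset.sum_congr rfl fun t _ => Finset.sum_congr rfl fun s2 _ =>
          Finset.sum_congr rfl fun y _ => ?_
        field_simp
    _ ≤ ∑ t, q s1 v2 t * (P * Finset.univ.sup' Finset.univ_nonempty F) := by
        gcongr with t _
        · exact (hq s1 v2 t).le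
        · exact Finset.le_sup' F (Finset.mem_univ t)
    _ = P * Finset.univ.sup' Finset.univ_nonempty F := by
        rw [← Finset.sum_mul, hq1, one_mul]

end MarginalBounds

/-- `J_w(q₀,Q*_{q₀}) ≤ U_w(q₁)` for any two strictly positive conditional
pmfs `q₀, q₁`; consequently `U_w(q₁)` upper-bounds the supremum of `J_w(q₀,Q*_{q₀})` over
all strictly positive conditional pmfs `q₀`. -/
theorem Jw_le_Uw {S1 S2 V2 T Y : Type*}
    [Fintype S1] [Fintype S2] [Fintype V2] [Fintype T] [Fintype Y]
    [Nonempty S1] [Nonempty S2] [Nonempty V2] [Nonempty T] [Nonempty Y]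
    (p : S1 → S2 → ℝ) (hp0 : ∀ s1 s2, 0 ≤ p s1 s2) (hp1 : ∑ s1, ∑ s2, p s1 s2 = 1)
    (w : S2 → V2 → ℝ) (hw0 : ∀ s2 v2, 0 ≤ w s2 v2) (hw1 : ∀ s2, ∑ v2, w s2 v2 = 1)
    (hpos : ∀ s1 v2, 0 < ∑ s2', p s1 s2' * w s2' v2)
    (ch : T → S1 → S2 → V2 → Y → ℝ)
    (hchpos : ∀ t s1 s2 v2 y, 0 < ch t s1 s2 v2 y)
    (hch1 : ∀ t s1 s2 v2, ∑ y, ch t s1 s2 v2 y = 1)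
    (q0 q1 : S1 → V2 → T → ℝ)
    (hq0pos : ∀ s1 v2 t, 0 < q0 s1 v2 t) (hq0sum : ∀ s1 v2, ∑ t, q0 s1 v2 t = 1)
    (hq1pos : ∀ s1 v2 t, 0 < q1 s1 v2 t) (hq1sum : ∀ s1 v2, ∑ t, q1 s1 v2 t = 1)
    (Q0 Q1 : Y → S2 → V2 → T → ℝ)
    (hQ00 : ∀ y s2 v2 t, 0 ≤ Q0 y s2 v2 t) (hQ01 : ∀ y s2 v2, ∑ t, Q0 y s2 v2 t = 1)
    (hQ0m : IsMarginalOf p w ch q0 Q0)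
    (hQ10 : ∀ y s2 v2 t, 0 ≤ Q1 y s2 v2 t) (hQ11 : ∀ y s2 v2, ∑ t, Q1 y s2 v2 t = 1)
    (hQ1m : IsMarginalOf p w ch q1 Q1) :
    Jw p w ch q0 Q0 ≤ Uw p w ch q1 Q1 ∧
    sSup {r : ℝ | ∃ q Qq : _,
        (∀ s1 v2 t, (0:ℝ) < q s1 v2 t) ∧ (∀ s1 v2, ∑ t, q s1 v2 t = 1) ∧
        (∀ y s2 v2 t, (0:ℝ) ≤ Qq y s2 v2 t) ∧ (∀ y s2 v2, ∑ t, Qq y s2 v2 t = 1) ∧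
        IsMarginalOf p w ch q Qq ∧ r = Jw p w ch q Qq} ≤
      Uw p w ch q1 Q1 := by
  have hbound (q : S1 → V2 → T → ℝ) (Q : Y → S2 → V2 → T → ℝ)
      (hq : ∀ s1 v2 t, 0 < q s1 v2 t) (hqsum : ∀ s1 v2, ∑ t, q s1 v2 t = 1)
      (hQ : ∀ y s2 v2 t, 0 ≤ Q y s2 v2 t) (hQsum : ∀ y s2 v2, ∑ t, Q y s2 v2 t = 1)
      (hQm : IsMarginalOf p w ch q Q) : Jw p w ch q Q ≤ Uw p w ch q1 Q1 := by
    have hsum : Jw p w ch q Q ≤ ∑ s1, ∑ s2, ∑ v2, ∑ t, ∑ y, _ :=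
      Finset.sum_le_sum fun s1 _ => Finset.sum_le_sum fun s2 _ => Finset.sum_le_sum fun v2 _ =>
        Finset.sum_le_sum fun t _ => Finset.sum_le_sum fun y _ =>
          jointW_mul_log_le hQm hQ hQ1m hQ10 hp0 hw0 hchpos hq hq1pos s1 s2 v2 t y
    simp only [Finset.sum_add_distrib, Finset.sum_sub_distrib] at hsum
    rw [sum_jointW_eq_one hp1 hw1 hch1 hqsum] at hsum
    have hU := sum_jointW_mul_log_le_Uw (ch := ch) (q' := q1) (Q' := Q1) hpos hq hqsum
    have hC := sum_jointW_mul_div_le_one hQsum hQ hQ1m hp0 hp1 hw0 hw1 hchpos hch1 hq1pos hq1sum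
    linarith
  refine ⟨hbound q0 Q0 hq0pos hq0sum hQ00 hQ01 hQ0m, csSup_le ?_ ?_⟩
  · exact ⟨_, q0, Q0, hq0pos, hq0sum, hQ00, hQ01, hQ0m, rfl⟩
  · rintro r ⟨q, Q, hq, hqsum, hQ, hQsum, hQm, rfl⟩
    exact hbound q Q hq hqsum hQ hQsum hQm
end

section
/- Weak duality for the Wyner–Ziv geometric program: let α ∈ ℝ^𝒳, y ∈ ℝ^{𝒳×𝒮×𝒯} and γ ≥ 0 satisfy (i) α_x + Σ_s p(s|x)[ log p(x|s) − γ d(x,t(s)) − y_{x,s,t} ] ≤ 0 for all x ∈ 𝒳 and t ∈ 𝒯, and (ii) log( Σ_x exp(y_{x,s,t}) ) ≤ 0 for all s ∈ 𝒮 and t ∈ 𝒯. Then for every conditional pmf q(t|x) satisfying the distortion constraint Σ_{x,s,t} p(x,s) q(t|x) d(x,t(s)) ≤ D, one has Σ_x p(x) α_x − γ D ≤ I(q). In particular Σ_x p(x) α_x − γ D ≤ R(D). -/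
open scoped Classical

/-- The induced conditional marginal `Q(t|s) = Σ_x p(x,s) q(t|x) / p(s)`. -/
noncomputable def Qmarg {X S Xh : Type*} [Fintype X]
    (p : X → S → ℝ) (q : X → (S → Xh) → ℝ) (t : S → Xh) (s : S) : ℝ :=
  (∑ x, p x s * q x t) / ∑ x, p x s

/-- The Wyner–Ziv objective `I(q) = Σ_{x,s,t} p(x,s) q(t|x) log( q(t|x) / Q(t|s) )`,
with the convention `0 log 0 = 0` (automatic since summands with `q(t|x) = 0` vanish). -/
noncomputable def Iobj {X S Xh : Type*} [Fintype X] [Fintype S] [Fintype Xh]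
    (p : X → S → ℝ) (q : X → (S → Xh) → ℝ) : ℝ :=
  ∑ x, ∑ s, ∑ t, p x s * q x t * Real.log (q x t / Qmarg p q t s)

/-- Each summand of the log-sum inequality dominates its linearization `a - A e^y`. -/
lemma wz_summand_lower_bound {X S Xh : Type*} [Fintype X]
    {p : X → S → ℝ} (hp : ∀ x s, 0 < p x s)
    {q : X → (S → Xh) → ℝ} (hq : ∀ x t, 0 ≤ q x t) (y : ℝ) (x : X) (s : S) (t : S → Xh) :
    p x s * q x t - (∑ x', p x' s * q x' t) * Real.exp y ≤
      p x s * q x t *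
        (Real.log (p x s / ∑ x', p x' s) - y + Real.log (q x t / Qmarg p q t s)) := by
  have hnn : ∀ x', 0 ≤ p x' s * q x' t := fun x' => mul_nonneg (hp x' s).le (hq x' t)
  rcases (hq x t).eq_or_lt with h0 | hpos
  · rw [← h0]
    have := mul_nonneg (Finset.sum_nonneg fun x' (_ : x' ∈ Finset.univ) => hnn x')
      (Real.exp_pos y).le
    simpa using this
  have ha : 0 < p x s * q x t := mul_pos (hp x s) hpos
  have hA : 0 < ∑ x', p x' s * q x' t :=
    ha.trans_le (Finset.single_le_sum (fun x' _ => hnn x') (Finset.mem_univ x))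
  have hP : 0 < ∑ x', p x' s :=
    (hp x s).trans_le (Finset.single_le_sum (fun x' _ => (hp x' s).le) (Finset.mem_univ x))
  have hpx := hp x s
  have hey := Real.exp_pos y
  unfold Qmarg
  set A := ∑ x', p x' s * q x' t
  set P := ∑ x', p x' s
  have hlog : Real.log (p x s / P) - y + Real.log (q x t / (A / P)) =
      Real.log (p x s * q x t / (A * Real.exp y)) := by
    rw [Real.log_div hpx.ne' hP.ne', Real.log_div hpos.ne' (div_pos hA hP).ne',
      Real.log_div hA.ne' hP.ne', Real.log_div ha.ne' (mul_pos hA hey).ne',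
      Real.log_mul hpx.ne' hpos.ne', Real.log_mul hA.ne' hey.ne', Real.log_exp]
    ring
  rw [hlog]
  have h := mul_le_mul_of_nonneg_left
    (Real.one_sub_inv_le_log_of_pos (div_pos ha (mul_pos hA hey))) ha.le
  refine le_trans (le_of_eq ?_) h
  rw [inv_div, mul_sub, mul_one, mul_div_cancel₀ _ ha.ne']

/-- A log-sum inequality: for sub-normalized weights `e^y`, the objective is bounded below by the
linear functional with coefficients `y - log p(x|s)`. -/
lemma sum_mul_sub_log_le_Iobj {X S Xh : Type*} [Fintype X] [Fintype S] [Fintype Xh]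
    {p : X → S → ℝ} (hp : ∀ x s, 0 < p x s)
    {q : X → (S → Xh) → ℝ} (hq : ∀ x t, 0 ≤ q x t) {y : X → S → (S → Xh) → ℝ}
    (hy : ∀ s t, ∑ x, Real.exp (y x s t) ≤ 1) :
    ∑ x, ∑ s, ∑ t, p x s * q x t * (y x s t - Real.log (p x s / ∑ x', p x' s)) ≤
      Iobj p q := by
  have hst : ∀ s t, 0 ≤ ∑ x, p x s * q x t *
      (Real.log (p x s / ∑ x', p x' s) - y x s t + Real.log (q x t / Qmarg p q t s)) := by
    intro s t
    refine le_trans ?_ (Finset.sum_le_sum fun x _ =>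
      wz_summand_lower_bound hp hq (y x s t) x s t)
    rw [Finset.sum_sub_distrib, ← Finset.mul_sum]
    have hA : 0 ≤ ∑ x, p x s * q x t :=
      Finset.sum_nonneg fun x _ => mul_nonneg (hp x s).le (hq x t)
    nlinarith [mul_le_mul_of_nonneg_left (hy s t) hA]
  have hsum := Finset.sum_nonneg fun s (_ : s ∈ Finset.univ) =>
    Finset.sum_nonneg fun t (_ : t ∈ Finset.univ) => hst s t
  simp_rw [Finset.sum_comm (s := (Finset.univ : Finset (S → Xh)))] at hsum
  rw [Finset.sum_comm] at hsum
  rw [← sub_nonneg, Iobj]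
  simp_rw [← Finset.sum_sub_distrib]
  refine hsum.trans_eq (Finset.sum_congr rfl fun x _ => Finset.sum_congr rfl fun s _ =>
    Finset.sum_congr rfl fun t _ => ?_)
  ring

/-- weak duality for the Wyner–Ziv geometric program.  If `(α, y, γ)` with
`γ ≥ 0` satisfies the two geometric-programming constraints, then the dual objective
`Σ_x p(x) α_x − γ D` is at most `I(q)` for every feasible test channel `q`, and in
particular it is at most `R(D)` (formalized as the infimum over feasible `q`). -/
theorem WZ_weak_duality {X S Xh : Type*} [Fintype X] [Fintype S] [Fintype Xh]
    [Nonempty X] [Nonempty S] [Nonempty Xh]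
    (p : X → S → ℝ) (hppos : ∀ x s, 0 < p x s) (hp1 : ∑ x, ∑ s, p x s = 1)
    (d : X → Xh → ℝ) (hd0 : ∀ x xh, 0 ≤ d x xh) (D : ℝ) (hD : 0 ≤ D)
    (hfeas : ∃ q : X → (S → Xh) → ℝ, (∀ x t, 0 ≤ q x t) ∧ (∀ x, ∑ t, q x t = 1) ∧
      (∑ x, ∑ s, ∑ t, p x s * q x t * d x (t s)) ≤ D)
    (α : X → ℝ) (y : X → S → (S → Xh) → ℝ) (γ : ℝ) (hγ : 0 ≤ γ)
    (hcon1 : ∀ (x : X) (t : S → Xh),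
      α x + ∑ s, (p x s / ∑ s', p x s') *
        (Real.log (p x s / ∑ x', p x' s) - γ * d x (t s) - y x s t) ≤ 0)
    (hcon2 : ∀ (s : S) (t : S → Xh), Real.log (∑ x, Real.exp (y x s t)) ≤ 0) :
    (∀ q : X → (S → Xh) → ℝ, (∀ x t, 0 ≤ q x t) → (∀ x, ∑ t, q x t = 1) →
      (∑ x, ∑ s, ∑ t, p x s * q x t * d x (t s)) ≤ D →
      (∑ x, (∑ s, p x s) * α x) - γ * D ≤ Iobj p q) ∧
    (∑ x, (∑ s, p x s) * α x) - γ * D ≤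
      sInf {r : ℝ | ∃ q : X → (S → Xh) → ℝ, (∀ x t, 0 ≤ q x t) ∧ (∀ x, ∑ t, q x t = 1) ∧
        (∑ x, ∑ s, ∑ t, p x s * q x t * d x (t s)) ≤ D ∧ r = Iobj p q} := by
  have hexp : ∀ s t, ∑ x, Real.exp (y x s t) ≤ 1 := fun s t =>
    (Real.log_nonpos_iff (Finset.sum_nonneg fun x _ => (Real.exp_pos _).le)).1 (hcon2 s t)
  have key : ∀ q : X → (S → Xh) → ℝ, (∀ x t, 0 ≤ q x t) → (∀ x, ∑ t, q x t = 1) →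
      (∑ x, ∑ s, ∑ t, p x s * q x t * d x (t s)) ≤ D →
      (∑ x, (∑ s, p x s) * α x) - γ * D ≤ Iobj p q := by
    intro q hq hq1 hqD
    have hI := sum_mul_sub_log_le_Iobj hppos hq hexp
    have hx : ∀ x, (∑ s, p x s) * α x ≤
        ∑ s, ∑ t, (p x s * q x t * (y x s t - Real.log (p x s / ∑ x', p x' s)) +
          γ * (p x s * q x t * d x (t s))) := by
      intro x
      have hP : 0 < ∑ s, p x s := Finset.sum_pos (fun s _ => hppos x s) Finset.univ_nonempty
      rw [Finset.sum_comm, ← mul_one ((∑ s, p x s) * α x), ← hq1 x, Finset.mul_sum]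
      refine Finset.sum_le_sum fun t _ => ?_
      have h := mul_le_mul_of_nonneg_left (hcon1 x t) (mul_nonneg hP.le (hq x t))
      rw [mul_zero, mul_add, Finset.mul_sum] at h
      have heq : ∑ s, (p x s * q x t * (y x s t - Real.log (p x s / ∑ x', p x' s)) +
          γ * (p x s * q x t * d x (t s))) =
          -∑ s, (∑ s, p x s) * q x t * ((p x s / ∑ s', p x s') *
            (Real.log (p x s / ∑ x', p x' s) - γ * d x (t s) - y x s t)) := by
        rw [← Finset.sum_neg_distrib]
        refine Finset.sum_congr rfl fun s _ => ?_
        generalize Real.log (p x s / ∑ x', p x' s) = L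
        field_simp
        ring
      rw [heq]
      linarith
    have hα := Finset.sum_le_sum fun x (_ : x ∈ Finset.univ) => hx x
    simp_rw [Finset.sum_add_distrib, ← Finset.mul_sum] at hα
    linarith [mul_le_mul_of_nonneg_left hqD hγ]
  refine ⟨key, le_csInf ?_ ?_⟩
  · obtain ⟨q, h0, h1, h2⟩ := hfeas
    exact ⟨_, q, h0, h1, h2, rfl⟩
  · rintro r ⟨q, h0, h1, h2, rfl⟩
    exact key q h0 h1 h2
end

section
/- Strong duality for the Wyner–Ziv geometric program: if Slater's condition holds, i.e., there exists a conditional pmf q̃ with q̃(t|x) > 0 for all t ∈ 𝒯, x ∈ 𝒳 and Σ_{x,s,t} p(x,s) q̃(t|x) d(x,t(s)) < D, then the supremum of Σ_x p(x) α_x − γ D over all (α, y, γ) with γ ≥ 0 satisfying (i) α_x + Σ_s p(s|x)[ log p(x|s) − γ d(x,t(s)) − y_{x,s,t} ] ≤ 0 for all x, t and (ii) log( Σ_x exp(y_{x,s,t}) ) ≤ 0 for all s, t, equals R(D). -/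
open scoped Classical

section WynerZivDuality

open Finset

variable {X S Xh : Type*}

/-- Clearing the denominator `p(x)` in the first dual constraint. -/
lemma dual_constraint_iff [Fintype S] [Nonempty S] {p : X → S → ℝ} (hp : ∀ x s, 0 < p x s) (a : ℝ)
    (f : S → ℝ) (x : X) :
    a + ∑ s, (p x s / ∑ s', p x s') * f s ≤ 0 ↔ (∑ s, p x s) * a + ∑ s, p x s * f s ≤ 0 := by
  have hP : 0 < ∑ s, p x s := sum_pos (fun s _ => hp x s) univ_nonempty
  have h : (∑ s, p x s) * a + ∑ s, p x s * f s =
      (∑ s, p x s) * (a + ∑ s, (p x s / ∑ s', p x s') * f s) := by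
    rw [mul_add, mul_sum univ]
    congr 1
    exact sum_congr rfl fun s _ => by field_simp
  rw [h, ← not_lt, ← not_lt, mul_pos_iff_of_pos_left hP]

lemma mul_log_sub_ge {r : ℝ} (hr : 0 ≤ r) (y : ℝ) :
    r - Real.exp y ≤ r * (Real.log r - y) := by
  rcases hr.eq_or_lt with rfl | hr
  · simpa using (Real.exp_pos y).le
  · have h := Real.add_one_le_exp (y - Real.log r)
    rw [Real.exp_sub, Real.exp_log hr, le_div_iff₀ hr] at h
    linarith

variable [Fintype X]

lemma marginal_pos [Nonempty X] {p : X → S → ℝ} (hp : ∀ x s, 0 < p x s) (s : S) :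
    0 < ∑ x, p x s :=
  sum_pos (fun x _ => hp x s) univ_nonempty

lemma marginal_mul_Qmarg [Nonempty X] {p : X → S → ℝ} (hp : ∀ x s, 0 < p x s)
    (q : X → (S → Xh) → ℝ) (t : S → Xh) (s : S) :
    (∑ x, p x s) * Qmarg p q t s = ∑ x, p x s * q x t := by
  unfold Qmarg
  exact mul_div_cancel₀ _ (marginal_pos hp s).ne'

lemma Qmarg_nonneg {p : X → S → ℝ} (hp : ∀ x s, 0 < p x s)
    {q : X → (S → Xh) → ℝ} (hq : ∀ x t, 0 ≤ q x t) (t : S → Xh) (s : S) :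
    0 ≤ Qmarg p q t s :=
  div_nonneg (sum_nonneg fun x _ => mul_nonneg (hp x s).le (hq x t))
    (sum_nonneg fun x _ => (hp x s).le)

lemma Qmarg_pos [Nonempty X] {p : X → S → ℝ} (hp : ∀ x s, 0 < p x s)
    {q : X → (S → Xh) → ℝ} (hq : ∀ x t, 0 ≤ q x t) {t : S → Xh} (s : S) {x : X}
    (hx : 0 < q x t) : 0 < Qmarg p q t s :=
  div_pos (sum_pos' (fun x _ => mul_nonneg (hp x s).le (hq x t))
    ⟨x, mem_univ x, mul_pos (hp x s) hx⟩) (marginal_pos hp s)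

lemma Qmarg_add_smul (p : X → S → ℝ) (q h : X → (S → Xh) → ℝ) (t : S → Xh) (s : S) (τ : ℝ) :
    Qmarg p (q + τ • h) t s = Qmarg p q t s + τ * Qmarg p h t s := by
  simp only [Qmarg, Pi.add_apply, Pi.smul_apply, smul_eq_mul, mul_div_assoc', mul_sum, ← add_div,
    ← sum_add_distrib]
  congr 1
  exact sum_congr rfl fun x _ => by ring

/-- The Gibbs inequality for the posterior distribution of `x` given `(s, t)`. -/
lemma sum_mul_log_posterior_ge [Nonempty X] {p : X → S → ℝ} (hp : ∀ x s, 0 < p x s)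
    {q : X → (S → Xh) → ℝ} (hq : ∀ x t, 0 ≤ q x t) (s : S) (t : S → Xh) {y : X → ℝ}
    (hy : Real.log (∑ x, Real.exp (y x)) ≤ 0) :
    ∑ x, p x s * q x t * (y x - Real.log (p x s / ∑ x', p x' s)) ≤
      ∑ x, p x s * q x t * Real.log (q x t / Qmarg p q t s) := by
  have hE : 0 < ∑ x, Real.exp (y x) := sum_pos (fun x _ => Real.exp_pos _) univ_nonempty
  have hE1 : ∑ x, Real.exp (y x) ≤ 1 := (Real.log_nonpos_iff hE.le).1 hy
  have hP := marginal_pos hp s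
  have hm := marginal_mul_Qmarg hp q t s
  rcases (Qmarg_nonneg hp hq t s).eq_or_lt with h0 | hQ
  · have hz : ∀ x, q x t = 0 := fun x => by
      by_contra hx
      exact (Qmarg_pos hp hq s ((hq x t).lt_of_ne' hx)).ne h0
    simp [hz]
  · set R := (∑ x, p x s) * Qmarg p q t s with hR
    have hRpos : 0 < R := mul_pos hP hQ
    have key : ∀ x, p x s * q x t - R * Real.exp (y x) ≤
        p x s * q x t * Real.log (q x t / Qmarg p q t s) -
          p x s * q x t * (y x - Real.log (p x s / ∑ x', p x' s)) := by
      intro x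
      have h1 := mul_le_mul_of_nonneg_left
        (mul_log_sub_ge (div_nonneg (mul_nonneg (hp x s).le (hq x t)) hRpos.le) (y x)) hRpos.le
      rcases (hq x t).eq_or_lt with hx | hx
      · rw [← hx]
        simpa using mul_nonneg hRpos.le (Real.exp_pos (y x)).le
      · have h2 : Real.log (p x s * q x t / R) =
            Real.log (q x t / Qmarg p q t s) + Real.log (p x s / ∑ x', p x' s) := by
          rw [← Real.log_mul (div_pos hx hQ).ne' (div_pos (hp x s) hP).ne', hR]
          congr 1
          field_simp
        rw [h2, mul_sub, mul_div_cancel₀ _ hRpos.ne', ← mul_assoc,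
          mul_div_cancel₀ _ hRpos.ne'] at h1
        linarith
    have hs := sum_le_sum fun x (_ : x ∈ univ) => key x
    rw [sum_sub_distrib, sum_sub_distrib, ← mul_sum, ← hm] at hs
    nlinarith

variable [Fintype S] [Fintype Xh]

/-- The total expected distortion of a test channel. -/
noncomputable def expectedDistortion (p : X → S → ℝ) (d : X → Xh → ℝ)
    (q : X → (S → Xh) → ℝ) : ℝ :=
  ∑ x, ∑ s, ∑ t, p x s * q x t * d x (t s)

/-- The Wyner–Ziv objective written as a difference of entropies, which is manifestly
continuous in the test channel. -/
noncomputable def entropyObj (p : X → S → ℝ) (q : X → (S → Xh) → ℝ) : ℝ :=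
  ∑ s, ∑ t, (∑ x, p x s * (q x t * Real.log (q x t)) -
    (∑ x, p x s) * (Qmarg p q t s * Real.log (Qmarg p q t s)))

/-- The logarithmic barrier function of the Wyner–Ziv program. -/
noncomputable def barrierObj (p : X → S → ℝ) (d : X → Xh → ℝ) (D ε : ℝ)
    (q : X → (S → Xh) → ℝ) : ℝ :=
  entropyObj p q - ε * (∑ x, ∑ t, Real.log (q x t) + Real.log (D - expectedDistortion p d q))

/-- The gradient of the barrier function, with multiplier `γ` for the distortion constraint. -/
noncomputable def barrierGrad (p : X → S → ℝ) (d : X → Xh → ℝ) (γ ε : ℝ)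
    (q : X → (S → Xh) → ℝ) (x : X) (t : S → Xh) : ℝ :=
  ∑ s, p x s * (Real.log (q x t) - Real.log (Qmarg p q t s) + γ * d x (t s)) - ε / q x t

/-- The strictly feasible test channels. -/
def IsStrictChannel (p : X → S → ℝ) (d : X → Xh → ℝ) (D : ℝ) (q : X → (S → Xh) → ℝ) : Prop :=
  (∀ x t, 0 < q x t) ∧ (∀ x, ∑ t, q x t = 1) ∧ expectedDistortion p d q < D

lemma continuous_entropyObj (p : X → S → ℝ) :
    Continuous (entropyObj p : (X → (S → Xh) → ℝ) → ℝ) := by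
  have hQ : ∀ (t : S → Xh) (s : S),
      Continuous fun q : X → (S → Xh) → ℝ => Qmarg p q t s := by
    intro t s
    unfold Qmarg
    fun_prop
  unfold entropyObj
  refine continuous_finsetSum _ fun s _ => continuous_finsetSum _ fun t _ => ?_
  refine Continuous.sub (continuous_finsetSum _ fun x _ => ?_) ?_
  · exact continuous_const.mul (Real.continuous_mul_log.comp
      ((continuous_apply t).comp (continuous_apply x)))
  · exact continuous_const.mul (Real.continuous_mul_log.comp (hQ t s))

lemma continuous_expectedDistortion (p : X → S → ℝ) (d : X → Xh → ℝ) :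
    Continuous (expectedDistortion p d) := by
  unfold expectedDistortion
  fun_prop

/-- The barrier function attains its minimum over the strictly feasible test channels. -/
lemma exists_isMin_barrierObj {p : X → S → ℝ} {d : X → Xh → ℝ} {D ε : ℝ} (hε : 0 < ε)
    (hS : ∃ q, IsStrictChannel p d D q) :
    ∃ q, IsStrictChannel p d D q ∧
      ∀ q', IsStrictChannel p d D q' → barrierObj p d D ε q ≤ barrierObj p d D ε q' := by
  let g : (X → (S → Xh) → ℝ) → ℝ := fun q =>
    Real.exp (-entropyObj p q / ε) * ((∏ x, ∏ t, q x t) * (D - expectedDistortion p d q))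
  let K : Set (X → (S → Xh) → ℝ) :=
    (Set.univ.pi fun _ => stdSimplex ℝ (S → Xh)) ∩ {q | expectedDistortion p d q ≤ D}
  have hK : IsCompact K :=
    (isCompact_univ_pi fun _ => isCompact_stdSimplex ℝ (S → Xh)).inter_right
      (isClosed_le (continuous_expectedDistortion p d) continuous_const)
  have hg : Continuous g := by
    have h1 := continuous_entropyObj (Xh := Xh) p
    have h2 := continuous_expectedDistortion p d
    have h3 : Continuous fun q : X → (S → Xh) → ℝ => ∏ x, ∏ t, q x t :=
      continuous_finsetProd _ fun x _ => continuous_finsetProd _ fun t _ => by fun_prop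
    exact (Real.continuous_exp.comp (h1.neg.div_const ε)).mul (h3.mul (continuous_const.sub h2))
  have hmem : ∀ q, IsStrictChannel p d D q → q ∈ K := fun q hq =>
    ⟨fun x _ => ⟨fun t => (hq.1 x t).le, hq.2.1 x⟩, hq.2.2.le⟩
  have hpos : ∀ q, IsStrictChannel p d D q → 0 < g q := fun q hq =>
    mul_pos (Real.exp_pos _) (mul_pos (prod_pos fun x _ => prod_pos fun t _ => hq.1 x t)
      (sub_pos.2 hq.2.2))
  have hlog : ∀ q, IsStrictChannel p d D q → Real.log (g q) = -barrierObj p d D ε q / ε := by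
    intro q hq
    have h1 : ∀ x, ∏ t, q x t ≠ 0 := fun x => (prod_pos fun t _ => hq.1 x t).ne'
    have h2 : ∏ x, ∏ t, q x t ≠ 0 := prod_ne_zero_iff.2 fun x _ => h1 x
    have h3 : D - expectedDistortion p d q ≠ 0 := (sub_pos.2 hq.2.2).ne'
    simp only [g]
    rw [Real.log_mul (Real.exp_pos _).ne' (mul_ne_zero h2 h3), Real.log_exp, Real.log_mul h2 h3,
      Real.log_prod fun x _ => h1 x,
      sum_congr rfl fun x _ => Real.log_prod fun t _ => (hq.1 x t).ne']
    unfold barrierObj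
    field_simp
    ring
  obtain ⟨q₀, hq₀⟩ := hS
  obtain ⟨q, hqK, hmax⟩ := hK.exists_isMaxOn ⟨q₀, hmem q₀ hq₀⟩ hg.continuousOn
  have hgq : g q ≠ 0 := ((hpos q₀ hq₀).trans_le (hmax (hmem q₀ hq₀))).ne'
  have hprod : ∏ x, ∏ t, q x t ≠ 0 := left_ne_zero_of_mul (right_ne_zero_of_mul hgq)
  have hdist : D - expectedDistortion p d q ≠ 0 :=
    right_ne_zero_of_mul (right_ne_zero_of_mul hgq)
  have hq : IsStrictChannel p d D q := by
    refine ⟨fun x t => lt_of_le_of_ne ((hqK.1 x trivial).1 t) (Ne.symm ?_),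
      fun x => (hqK.1 x trivial).2, lt_of_le_of_ne hqK.2 fun h => hdist (sub_eq_zero.2 h.symm)⟩
    exact prod_ne_zero_iff.1 (prod_ne_zero_iff.1 hprod x (mem_univ x)) t (mem_univ t)
  refine ⟨q, hq, fun q' hq' => ?_⟩
  have h := Real.log_le_log (hpos q' hq') (hmax (hmem q' hq'))
  rw [hlog q hq, hlog q' hq', div_le_div_iff_of_pos_right hε] at h
  linarith

lemma expectedDistortion_add_smul (p : X → S → ℝ) (d : X → Xh → ℝ) (q h : X → (S → Xh) → ℝ)
    (τ : ℝ) : expectedDistortion p d (q + τ • h) =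
      expectedDistortion p d q + τ * expectedDistortion p d h := by
  simp only [expectedDistortion, Pi.add_apply, Pi.smul_apply, smul_eq_mul, mul_sum,
    ← sum_add_distrib]
  exact sum_congr rfl fun x _ => sum_congr rfl fun s _ => sum_congr rfl fun t _ => by ring

lemma hasDerivAt_add_mul (a b : ℝ) : HasDerivAt (fun τ : ℝ => a + τ * b) b 0 := by
  simpa using ((hasDerivAt_id (0 : ℝ)).mul_const b).const_add a

lemma hasDerivAt_log_add_mul {a : ℝ} (ha : a ≠ 0) (b : ℝ) :
    HasDerivAt (fun τ : ℝ => Real.log (a + τ * b)) (b / a) 0 := by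
  simpa using (hasDerivAt_add_mul a b).log (by simpa using ha)

lemma hasDerivAt_mul_log_add_mul {a : ℝ} (ha : a ≠ 0) (b : ℝ) :
    HasDerivAt (fun τ : ℝ => (a + τ * b) * Real.log (a + τ * b)) (b * Real.log a + b) 0 := by
  refine ((hasDerivAt_add_mul a b).fun_mul (hasDerivAt_log_add_mul ha b)).congr_deriv ?_
  simp only [zero_mul, add_zero]
  rw [mul_div_cancel₀ _ ha]

lemma hasDerivAt_entropyObj [Nonempty X] {p : X → S → ℝ} (hp : ∀ x s, 0 < p x s)
    {q : X → (S → Xh) → ℝ} (hq : ∀ x t, 0 < q x t) (h : X → (S → Xh) → ℝ) :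
    HasDerivAt (fun τ : ℝ => entropyObj p (q + τ • h))
      (∑ s, ∑ t, ∑ x, p x s * h x t * (Real.log (q x t) - Real.log (Qmarg p q t s))) 0 := by
  obtain ⟨x₀⟩ := ‹Nonempty X›
  have hQ : ∀ t s, Qmarg p q t s ≠ 0 := fun t s =>
    (Qmarg_pos hp (fun x t => (hq x t).le) s (hq x₀ t)).ne'
  have key : HasDerivAt (fun τ : ℝ => entropyObj p (q + τ • h))
      (∑ s, ∑ t, (∑ x, p x s * (h x t * Real.log (q x t) + h x t) -
        (∑ x, p x s) * (Qmarg p h t s * Real.log (Qmarg p q t s) + Qmarg p h t s))) 0 := by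
    simp only [entropyObj, Qmarg_add_smul, Pi.add_apply, Pi.smul_apply, smul_eq_mul]
    exact HasDerivAt.fun_sum fun s _ => HasDerivAt.fun_sum fun t _ =>
      (HasDerivAt.fun_sum fun x _ =>
        (hasDerivAt_mul_log_add_mul (hq x t).ne' (h x t)).const_mul (p x s)).fun_sub
        ((hasDerivAt_mul_log_add_mul (hQ t s) (Qmarg p h t s)).const_mul _)
  refine key.congr_deriv (Eq.symm ?_)
  refine sum_congr rfl fun s _ => sum_congr rfl fun t _ => ?_
  have hm := marginal_mul_Qmarg hp h t s
  rw [mul_add, ← mul_assoc, hm, sum_mul, ← sum_add_distrib, ← sum_sub_distrib]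
  exact sum_congr rfl fun x _ => by ring

lemma sum_mul_barrierGrad (p : X → S → ℝ) (d : X → Xh → ℝ) (γ ε : ℝ)
    (q h : X → (S → Xh) → ℝ) :
    ∑ x, ∑ t, h x t * barrierGrad p d γ ε q x t =
      ∑ s, ∑ t, ∑ x, p x s * h x t * (Real.log (q x t) - Real.log (Qmarg p q t s)) +
        γ * expectedDistortion p d h - ε * ∑ x, ∑ t, h x t / q x t := by
  rw [sum_comm_cycle]
  simp only [expectedDistortion, mul_sum, ← sum_add_distrib, ← sum_sub_distrib]
  refine sum_congr rfl fun x _ => ?_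
  rw [sum_comm, ← sum_sub_distrib]
  refine sum_congr rfl fun t _ => ?_
  simp only [barrierGrad, mul_sub, mul_sum]
  congr 1
  · exact sum_congr rfl fun s _ => by ring
  · ring

lemma hasDerivAt_barrierObj [Nonempty X] {p : X → S → ℝ} (hp : ∀ x s, 0 < p x s)
    {d : X → Xh → ℝ} {D : ℝ} {q : X → (S → Xh) → ℝ} (hq : IsStrictChannel p d D q) (ε : ℝ)
    (h : X → (S → Xh) → ℝ) :
    HasDerivAt (fun τ : ℝ => barrierObj p d D ε (q + τ • h))
      (∑ x, ∑ t, h x t * barrierGrad p d (ε / (D - expectedDistortion p d q)) ε q x t) 0 := by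
  have hD : D - expectedDistortion p d q ≠ 0 := (sub_pos.2 hq.2.2).ne'
  have h1 : HasDerivAt (fun τ : ℝ => Real.log (D - expectedDistortion p d (q + τ • h)))
      (-expectedDistortion p d h / (D - expectedDistortion p d q)) 0 := by
    convert hasDerivAt_log_add_mul hD (-expectedDistortion p d h) using 3 with τ
    rw [expectedDistortion_add_smul]
    ring
  have h2 : HasDerivAt (fun τ : ℝ => ∑ x, ∑ t, Real.log ((q + τ • h) x t))
      (∑ x, ∑ t, h x t / q x t) 0 := by
    simp only [Pi.add_apply, Pi.smul_apply, smul_eq_mul]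
    exact HasDerivAt.fun_sum fun x _ => HasDerivAt.fun_sum fun t _ =>
      hasDerivAt_log_add_mul (hq.1 x t).ne' (h x t)
  refine ((hasDerivAt_entropyObj hp hq.1 h).fun_sub ((h2.fun_add h1).const_mul ε)).congr_deriv ?_
  rw [sum_mul_barrierGrad]
  ring

lemma eventually_isStrictChannel {p : X → S → ℝ} {d : X → Xh → ℝ} {D : ℝ}
    {q : X → (S → Xh) → ℝ} (hq : IsStrictChannel p d D q) {h : X → (S → Xh) → ℝ}
    (hh : ∀ x, ∑ t, h x t = 0) :
    ∀ᶠ τ : ℝ in nhds 0, IsStrictChannel p d D (q + τ • h) := by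
  have hline : Continuous fun τ : ℝ => q + τ • h := by fun_prop
  have h1 : ∀ᶠ τ : ℝ in nhds 0, ∀ x t, 0 < (q + τ • h) x t := by
    simp only [Filter.eventually_all]
    intro x t
    have hc : Continuous fun τ : ℝ => (q + τ • h) x t := by
      simp only [Pi.add_apply, Pi.smul_apply]
      fun_prop
    exact hc.continuousAt.eventually_const_lt (by simpa using hq.1 x t)
  have h2 : ∀ᶠ τ : ℝ in nhds 0, expectedDistortion p d (q + τ • h) < D :=
    ((continuous_expectedDistortion p d).comp hline).continuousAt.eventually_lt_const
      (by simpa using hq.2.2)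
  filter_upwards [h1, h2] with τ hτ1 hτ2
  refine ⟨hτ1, fun x => ?_, hτ2⟩
  simp [sum_add_distrib, ← mul_sum, hq.2.1 x, hh x]

/-- At a minimizer of the barrier function the gradient does not depend on `t`. -/
lemma barrierGrad_eq_of_isMin [Nonempty X] {p : X → S → ℝ} (hp : ∀ x s, 0 < p x s)
    {d : X → Xh → ℝ} {D ε : ℝ} {q : X → (S → Xh) → ℝ} (hq : IsStrictChannel p d D q)
    (hmin : ∀ q', IsStrictChannel p d D q' → barrierObj p d D ε q ≤ barrierObj p d D ε q') :
    ∃ l : X → ℝ, ∀ x t,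
      barrierGrad p d (ε / (D - expectedDistortion p d q)) ε q x t = l x := by
  set G := barrierGrad p d (ε / (D - expectedDistortion p d q)) ε q with hG
  let l : X → ℝ := fun x => ∑ t, q x t * G x t
  let h : X → (S → Xh) → ℝ := fun x t => q x t * (G x t - l x)
  have hh : ∀ x, ∑ t, h x t = 0 := by
    intro x
    simp only [h, mul_sub, sum_sub_distrib, ← sum_mul, hq.2.1 x]
    simp [l]
  have hloc : IsLocalMin (fun τ : ℝ => barrierObj p d D ε (q + τ • h)) 0 := by
    filter_upwards [eventually_isStrictChannel hq hh] with τ hτ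
    simpa using hmin _ hτ
  have hzero := hloc.hasDerivAt_eq_zero (hasDerivAt_barrierObj hp hq ε h)
  rw [← hG] at hzero
  have hsq : ∑ x, ∑ t, q x t * (G x t - l x) ^ 2 = 0 := by
    rw [← hzero]
    refine sum_congr rfl fun x _ => ?_
    have : ∑ t, h x t * l x = 0 := by rw [← sum_mul, hh x, zero_mul]
    rw [← sub_zero (∑ t, h x t * G x t), ← this, ← sum_sub_distrib]
    exact sum_congr rfl fun t _ => by simp only [h]; ring
  have hnn : ∀ x t, 0 ≤ q x t * (G x t - l x) ^ 2 := fun x t =>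
    mul_nonneg (hq.1 x t).le (sq_nonneg _)
  refine ⟨l, fun x t => ?_⟩
  have h1 := (sum_eq_zero_iff_of_nonneg fun x _ => sum_nonneg fun t _ => hnn x t).1 hsq x
    (mem_univ x)
  have h2 := (sum_eq_zero_iff_of_nonneg fun t _ => hnn x t).1 h1 t (mem_univ t)
  have h3 := (mul_eq_zero.1 h2).resolve_left (hq.1 x t).ne'
  exact sub_eq_zero.1 (pow_eq_zero_iff two_ne_zero |>.1 h3)

/-- Feasibility for the dual geometric program. -/
def IsDualFeasible (p : X → S → ℝ) (d : X → Xh → ℝ) (α : X → ℝ) (y : X → S → (S → Xh) → ℝ)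
    (γ : ℝ) : Prop :=
  (∀ (x : X) (t : S → Xh), α x + ∑ s, (p x s / ∑ s', p x s') *
    (Real.log (p x s / ∑ x', p x' s) - γ * d x (t s) - y x s t) ≤ 0) ∧
  ∀ (s : S) (t : S → Xh), Real.log (∑ x, Real.exp (y x s t)) ≤ 0

/-- Weak duality. -/
lemma dual_le_Iobj [Nonempty X] [Nonempty S] {p : X → S → ℝ} (hp : ∀ x s, 0 < p x s)
    {d : X → Xh → ℝ} {D : ℝ} {α : X → ℝ} {y : X → S → (S → Xh) → ℝ} {γ : ℝ} (hγ : 0 ≤ γ)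
    (hdual : IsDualFeasible p d α y γ) {q : X → (S → Xh) → ℝ} (hq : ∀ x t, 0 ≤ q x t)
    (hq1 : ∀ x, ∑ t, q x t = 1) (hqD : expectedDistortion p d q ≤ D) :
    (∑ x, (∑ s, p x s) * α x) - γ * D ≤ Iobj p q := by
  have h1 : ∑ x, (∑ s, p x s) * α x ≤ ∑ x, ∑ t, ∑ s,
      (p x s * q x t * (y x s t - Real.log (p x s / ∑ x', p x' s)) +
        γ * (p x s * q x t * d x (t s))) := by
    refine sum_le_sum fun x _ => ?_
    rw [← one_mul ((∑ s, p x s) * α x), ← hq1 x, sum_mul]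
    refine sum_le_sum fun t _ => ?_
    have h := (dual_constraint_iff hp _ _ x).1 (hdual.1 x t)
    have h' : (∑ s, p x s) * α x ≤ -∑ s, p x s *
        (Real.log (p x s / ∑ x', p x' s) - γ * d x (t s) - y x s t) := by linarith
    refine (mul_le_mul_of_nonneg_left h' (hq x t)).trans_eq ?_
    rw [← sum_neg_distrib, mul_sum]
    exact sum_congr rfl fun s _ => by ring
  have h2 : ∑ x, ∑ s, ∑ t, p x s * q x t * (y x s t - Real.log (p x s / ∑ x', p x' s)) ≤
      Iobj p q := by
    unfold Iobj
    refine sum_comm_cycle.symm.trans_le (le_trans ?_ sum_comm_cycle.le)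
    exact sum_le_sum fun s _ => sum_le_sum fun t _ =>
      sum_mul_log_posterior_ge hp hq s t (hdual.2 s t)
  have h3 : ∑ x, ∑ t, ∑ s,
      (p x s * q x t * (y x s t - Real.log (p x s / ∑ x', p x' s)) +
        γ * (p x s * q x t * d x (t s))) =
      ∑ x, ∑ s, ∑ t, p x s * q x t * (y x s t - Real.log (p x s / ∑ x', p x' s)) +
        γ * expectedDistortion p d q := by
    simp only [expectedDistortion, mul_sum, ← sum_add_distrib]
    exact sum_congr rfl fun x _ => sum_comm
  nlinarith [mul_le_mul_of_nonneg_left hqD hγ]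

/-- Approximate strong duality: minimizers of the barrier function yield a feasible test channel
and a dual feasible point with duality gap proportional to the barrier parameter. -/
lemma exists_dual_gap_le [Nonempty X] [Nonempty S] {p : X → S → ℝ} (hp : ∀ x s, 0 < p x s)
    {d : X → Xh → ℝ} {D ε : ℝ} (hε : 0 < ε) (hS : ∃ q, IsStrictChannel p d D q) :
    ∃ q α y γ, IsStrictChannel p d D q ∧ 0 ≤ γ ∧ IsDualFeasible p d α y γ ∧
      Iobj p q ≤ (∑ x, (∑ s, p x s) * α x) - γ * D +
        ε * (Fintype.card X * Fintype.card (S → Xh) + 1) := by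
  obtain ⟨q, hq, hmin⟩ := exists_isMin_barrierObj hε hS
  obtain ⟨l, hl⟩ := barrierGrad_eq_of_isMin hp hq hmin
  have hD : 0 < D - expectedDistortion p d q := sub_pos.2 hq.2.2
  set γ := ε / (D - expectedDistortion p d q)
  have hP : ∀ x, 0 < ∑ s, p x s := fun x => sum_pos (fun s _ => hp x s) univ_nonempty
  have hQ : ∀ t s, 0 < Qmarg p q t s := fun t s =>
    Qmarg_pos hp (fun x t => (hq.1 x t).le) s (hq.1 (Classical.arbitrary X) t)
  have hpost : ∀ x s t, 0 < p x s / (∑ x', p x' s) * (q x t / Qmarg p q t s) := fun x s t =>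
    mul_pos (div_pos (hp x s) (marginal_pos hp s)) (div_pos (hq.1 x t) (hQ t s))
  refine ⟨q, fun x => l x / ∑ s, p x s,
    fun x s t => Real.log (p x s / (∑ x', p x' s) * (q x t / Qmarg p q t s)), γ, hq,
    (div_pos hε hD).le, ⟨fun x t => ?_, fun s t => ?_⟩, ?_⟩
  · rw [dual_constraint_iff hp, mul_div_cancel₀ _ (hP x).ne', ← hl x t, barrierGrad]
    have hs : ∑ s, p x s * (Real.log (p x s / ∑ x', p x' s) - γ * d x (t s) -
        Real.log (p x s / (∑ x', p x' s) * (q x t / Qmarg p q t s))) =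
        -∑ s, p x s * (Real.log (q x t) - Real.log (Qmarg p q t s) + γ * d x (t s)) := by
      rw [← sum_neg_distrib]
      refine sum_congr rfl fun s _ => ?_
      rw [Real.log_mul (div_pos (hp x s) (marginal_pos hp s)).ne'
        (div_pos (hq.1 x t) (hQ t s)).ne', Real.log_div (hq.1 x t).ne' (hQ t s).ne']
      ring
    rw [hs]
    have := div_pos hε (hq.1 x t)
    linarith
  · have hs : ∑ x, Real.exp (Real.log (p x s / (∑ x', p x' s) * (q x t / Qmarg p q t s))) =
        (∑ x, p x s * q x t) / ((∑ x, p x s) * Qmarg p q t s) := by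
      rw [sum_div]
      exact sum_congr rfl fun x _ => by rw [Real.exp_log (hpost x s t), div_mul_div_comm]
    rw [hs, ← marginal_mul_Qmarg hp,
      div_self (mul_pos (marginal_pos hp s) (hQ t s)).ne', Real.log_one]
  · have h1 : ∑ x, (∑ s, p x s) * (l x / ∑ s, p x s) =
        ∑ x, ∑ t, q x t * barrierGrad p d γ ε q x t := by
      refine sum_congr rfl fun x _ => ?_
      rw [mul_div_cancel₀ _ (hP x).ne', sum_congr rfl fun t _ => by rw [hl x t], ← sum_mul,
        hq.2.1 x, one_mul]
    have h2 : ∑ s, ∑ t, ∑ x, p x s * q x t * (Real.log (q x t) - Real.log (Qmarg p q t s)) =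
        Iobj p q := by
      refine Eq.trans ?_ sum_comm_cycle
      refine sum_congr rfl fun s _ => sum_congr rfl fun t _ => sum_congr rfl fun x _ => ?_
      rw [Real.log_div (hq.1 x t).ne' (hQ t s).ne']
    have h3 : ∑ x, ∑ t, q x t / q x t = (Fintype.card X * Fintype.card (S → Xh) : ℝ) := by
      simp [fun x t => div_self (hq.1 x t).ne', -Fintype.card_pi]
    have h4 : γ * (D - expectedDistortion p d q) = ε := div_mul_cancel₀ _ hD.ne'
    rw [h1, sum_mul_barrierGrad, h2, h3]
    linarith

end WynerZivDuality

/-- strong duality for the Wyner–Ziv geometric program.  Under Slater's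
condition, the supremum of the dual objective `Σ_x p(x) α_x − γ D` over all feasible
`(α, y, γ)` equals the Wyner–Ziv value `R(D)` (the infimum of `I(q)` over feasible
test channels `q`). -/
theorem WZ_strong_duality {X S Xh : Type*} [Fintype X] [Fintype S] [Fintype Xh]
    [Nonempty X] [Nonempty S] [Nonempty Xh]
    (p : X → S → ℝ) (hppos : ∀ x s, 0 < p x s) (hp1 : ∑ x, ∑ s, p x s = 1)
    (d : X → Xh → ℝ) (hd0 : ∀ x xh, 0 ≤ d x xh) (D : ℝ) (hD : 0 ≤ D)
    (hSlater : ∃ q : X → (S → Xh) → ℝ, (∀ x t, 0 < q x t) ∧ (∀ x, ∑ t, q x t = 1) ∧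
      (∑ x, ∑ s, ∑ t, p x s * q x t * d x (t s)) < D) :
    sSup {r : ℝ | ∃ (α : X → ℝ) (y : X → S → (S → Xh) → ℝ) (γ : ℝ),
        0 ≤ γ ∧
        (∀ (x : X) (t : S → Xh),
          α x + ∑ s, (p x s / ∑ s', p x s') *
            (Real.log (p x s / ∑ x', p x' s) - γ * d x (t s) - y x s t) ≤ 0) ∧
        (∀ (s : S) (t : S → Xh), Real.log (∑ x, Real.exp (y x s t)) ≤ 0) ∧
        r = (∑ x, (∑ s, p x s) * α x) - γ * D} =
      sInf {r : ℝ | ∃ q : X → (S → Xh) → ℝ, (∀ x t, 0 ≤ q x t) ∧ (∀ x, ∑ t, q x t = 1) ∧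
        (∑ x, ∑ s, ∑ t, p x s * q x t * d x (t s)) ≤ D ∧ r = Iobj p q} := by
  have hS : ∃ q, IsStrictChannel p d D q := hSlater
  obtain ⟨q₀, α₀, y₀, γ₀, hq₀, hγ₀, hdual₀, -⟩ := exists_dual_gap_le hppos one_pos hS
  set A := {r : ℝ | ∃ (α : X → ℝ) (y : X → S → (S → Xh) → ℝ) (γ : ℝ), 0 ≤ γ ∧ _}
  set B := {r : ℝ | ∃ q : X → (S → Xh) → ℝ, (∀ x t, 0 ≤ q x t) ∧ _}
  have hweak : ∀ a ∈ A, ∀ b ∈ B, a ≤ b := by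
    rintro a ⟨α, y, γ, hγ, h1, h2, rfl⟩ b ⟨q, hq, hq1, hqD, rfl⟩
    exact dual_le_Iobj hppos hγ ⟨h1, h2⟩ hq hq1 hqD
  have hmemA : ∀ {α y γ}, 0 ≤ γ → IsDualFeasible p d α y γ →
      (∑ x, (∑ s, p x s) * α x) - γ * D ∈ A :=
    fun hγ h => ⟨_, _, _, hγ, h.1, h.2, rfl⟩
  have hmemB : ∀ {q}, IsStrictChannel p d D q → Iobj p q ∈ B :=
    fun hq => ⟨_, fun x t => (hq.1 x t).le, hq.2.1, hq.2.2.le, rfl⟩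
  have hA₀ := hmemA hγ₀ hdual₀
  have hB₀ := hmemB hq₀
  refine le_antisymm (csSup_le ⟨_, hA₀⟩ fun a ha => le_csInf ⟨_, hB₀⟩ (hweak a ha)) ?_
  refine le_of_forall_pos_le_add fun δ hδ => ?_
  have hC : (0 : ℝ) < Fintype.card X * Fintype.card (S → Xh) + 1 := by positivity
  obtain ⟨q, α, y, γ, hq, hγ, hdual, hgap⟩ := exists_dual_gap_le hppos (div_pos hδ hC) hS
  rw [div_mul_cancel₀ _ hC.ne'] at hgap
  have h1 : sInf B ≤ Iobj p q := csInf_le ⟨_, hweak _ hA₀⟩ (hmemB hq)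
  have h2 := le_csSup (⟨_, fun a ha => hweak a ha _ hB₀⟩ : BddAbove A) (hmemA hγ hdual)
  linarith
end

section
/- Stationary value of the Wyner–Ziv Lagrangian: let μ ∈ ℝ^𝒳, γ ∈ ℝ, λ ∈ ℝ^{𝒳×𝒯}, and let q be a strictly positive conditional pmf on 𝒯 given 𝒳 which satisfies the stationarity condition Σ_s p(x,s) log( q(t|x) / Q_q(t|s) ) + μ_x + γ Σ_s p(x,s) d(x,t(s)) − λ_{x,t} = 0 for all x ∈ 𝒳 and t ∈ 𝒯. Then the Lagrangian evaluates to L(q, μ, γ, λ) = −Σ_x μ_x − γ D. -/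
open scoped Classical

/-- The Wyner–Ziv Lagrangian
`L(q,μ,γ,λ) = I(q) + Σ_x μ_x (Σ_t q(t|x) − 1) + γ (Σ p q d − D) − Σ_{x,t} λ_{x,t} q(t|x)`. -/
noncomputable def Lagr {X S Xh : Type*} [Fintype X] [Fintype S] [Fintype Xh]
    (p : X → S → ℝ) (d : X → Xh → ℝ) (D : ℝ)
    (q : X → (S → Xh) → ℝ) (μ : X → ℝ) (γ : ℝ) (lam : X → (S → Xh) → ℝ) : ℝ :=
  Iobj p q + (∑ x, μ x * ((∑ t, q x t) - 1)) +
    γ * ((∑ x, ∑ s, ∑ t, p x s * q x t * d x (t s)) - D) -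
    ∑ x, ∑ t, lam x t * q x t

/-- if a strictly positive conditional pmf `q` satisfies the stationarity
condition of the Wyner–Ziv Lagrangian, then the Lagrangian evaluates to
`−Σ_x μ_x − γ D`. -/
theorem WZ_stationary_value {X S Xh : Type*} [Fintype X] [Fintype S] [Fintype Xh]
    [Nonempty X] [Nonempty S] [Nonempty Xh]
    (p : X → S → ℝ) (hppos : ∀ x s, 0 < p x s) (hp1 : ∑ x, ∑ s, p x s = 1)
    (d : X → Xh → ℝ) (hd0 : ∀ x xh, 0 ≤ d x xh) (D : ℝ) (hD : 0 ≤ D)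
    (μ : X → ℝ) (γ : ℝ) (lam : X → (S → Xh) → ℝ)
    (q : X → (S → Xh) → ℝ)
    (hqpos : ∀ x t, 0 < q x t) (hq1 : ∀ x, ∑ t, q x t = 1)
    (hstat : ∀ (x : X) (t : S → Xh),
      (∑ s, p x s * Real.log (q x t / Qmarg p q t s)) + μ x +
        γ * (∑ s, p x s * d x (t s)) - lam x t = 0) :
    Lagr p d D q μ γ lam = -(∑ x, μ x) - γ * D := by
  have hsum : ∀ f : X → S → (S → Xh) → ℝ,
      ∑ x, ∑ s, ∑ t, p x s * q x t * f x s t = ∑ x, ∑ t, q x t * ∑ s, p x s * f x s t := by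
    intro f
    refine Finset.sum_congr rfl fun x _ => ?_
    rw [Finset.sum_comm]
    refine Finset.sum_congr rfl fun t _ => ?_
    rw [Finset.mul_sum]
    exact Finset.sum_congr rfl fun s _ => by ring
  have hμ : ∑ x, ∑ t, q x t * μ x = ∑ x, μ x :=
    Finset.sum_congr rfl fun x _ => by rw [← Finset.sum_mul, hq1, one_mul]
  have hzero : ∑ x, ∑ t, (q x t * (∑ s, p x s * Real.log (q x t / Qmarg p q t s)) +
      q x t * μ x + γ * (q x t * ∑ s, p x s * d x (t s)) - lam x t * q x t) = 0 :=
    Finset.sum_eq_zero fun x _ => Finset.sum_eq_zero fun t _ => by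
      linear_combination q x t * hstat x t
  simp only [Finset.sum_add_distrib, Finset.sum_sub_distrib, ← Finset.mul_sum] at hzero
  rw [hμ] at hzero
  unfold Lagr Iobj
  rw [hsum fun x s t => Real.log (q x t / Qmarg p q t s), hsum fun x s t => d x (t s)]
  simp only [hq1, sub_self, mul_zero, Finset.sum_const_zero]
  linear_combination hzero
end

section
/- For a fixed conditional pmf p(u,v₁|s₁), the function F(π) := I(U;Y,S₂|V₁) − I(U;S₁|V₁), computed with respect to the joint pmf induced by the conditional pmf π(x|u,s₁,v₁), is a convex function of π on the convex set of conditional pmfs π(x|u,s₁,v₁). -/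
open scoped Classical

/-- The probability of the event `f = a` under the pmf `P` on a finite space. -/
noncomputable def pr {Ω A : Type*} [Fintype Ω] (P : Ω → ℝ) (f : Ω → A) (a : A) : ℝ :=
  ∑ ω, if f ω = a then P ω else 0

/-- Shannon entropy `H(f)` (convention `0 log 0 = 0`, automatic since `Real.log 0 = 0`). -/
noncomputable def ent {Ω A : Type*} [Fintype Ω] [Fintype A] (P : Ω → ℝ) (f : Ω → A) : ℝ :=
  -∑ a, pr P f a * Real.log (pr P f a)

/-- Mutual information `I(f;g) = H(f) + H(g) − H(f,g)`. -/
noncomputable def mi {Ω A B : Type*} [Fintype Ω] [Fintype A] [Fintype B]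
    (P : Ω → ℝ) (f : Ω → A) (g : Ω → B) : ℝ :=
  ent P f + ent P g - ent P (fun ω => (f ω, g ω))

/-- Conditional mutual information `I(f;g|h) = H(f,h) + H(g,h) − H(f,g,h) − H(h)`. -/
noncomputable def cmi {Ω A B C : Type*} [Fintype Ω] [Fintype A] [Fintype B] [Fintype C]
    (P : Ω → ℝ) (f : Ω → A) (g : Ω → B) (h : Ω → C) : ℝ :=
  ent P (fun ω => (f ω, h ω)) + ent P (fun ω => (g ω, h ω)) -
    ent P (fun ω => (f ω, g ω, h ω)) - ent P h

/-- The joint pmf `p(s₁,s₂,v₁,u,x,y) = p(s₁,s₂) p(u,v₁|s₁) π(x|u,s₁,v₁) p(y|x,s₁,s₂)`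
as a pmf on the product space `S1 × S2 × V1 × U × X × Y`. -/
noncomputable def jointCC {S1 S2 V1 U X Y : Type*}
    (p : S1 → S2 → ℝ) (puv : S1 → U → V1 → ℝ) (ch : X → S1 → S2 → Y → ℝ)
    (π : U → S1 → V1 → X → ℝ) : S1 × S2 × V1 × U × X × Y → ℝ :=
  fun ω => p ω.1 ω.2.1 * puv ω.1 ω.2.2.2.1 ω.2.2.1 *
    π ω.2.2.2.1 ω.1 ω.2.2.1 ω.2.2.2.2.1 * ch ω.2.2.2.2.1 ω.1 ω.2.1 ω.2.2.2.2.2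

/-- `F(π) = I(U;Y,S₂|V₁) − I(U;S₁|V₁)`, computed for `(S₁,S₂,V₁,U,X,Y)` jointly
distributed according to the joint pmf induced by `π`. -/
noncomputable def Fcc {S1 S2 V1 U X Y : Type*}
    [Fintype S1] [Fintype S2] [Fintype V1] [Fintype U] [Fintype X] [Fintype Y]
    (p : S1 → S2 → ℝ) (puv : S1 → U → V1 → ℝ) (ch : X → S1 → S2 → Y → ℝ)
    (π : U → S1 → V1 → X → ℝ) : ℝ :=
  cmi (jointCC p puv ch π) (fun ω => ω.2.2.2.1) (fun ω => (ω.2.2.2.2.2, ω.2.1))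
      (fun ω => ω.2.2.1) -
    cmi (jointCC p puv ch π) (fun ω => ω.2.2.2.1) (fun ω => ω.1) (fun ω => ω.2.2.1)

lemma pr_nonneg {Ω A : Type*} [Fintype Ω] {P : Ω → ℝ} (hP : ∀ ω, 0 ≤ P ω)
    (f : Ω → A) (a : A) : 0 ≤ pr P f a :=
  Finset.sum_nonneg fun ω _ => by split_ifs <;> simp [hP ω]

lemma pr_combination {Ω A : Type*} [Fintype Ω] (P Q : Ω → ℝ) (s t : ℝ) (f : Ω → A) (a : A) :
    pr (fun ω => s * P ω + t * Q ω) f a = s * pr P f a + t * pr Q f a := by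
  simp only [pr, Finset.mul_sum, ← Finset.sum_add_distrib]
  refine Finset.sum_congr rfl fun ω _ => ?_
  split_ifs <;> simp

lemma sum_pr_prodMk {Ω A B : Type*} [Fintype Ω] [Fintype A] (P : Ω → ℝ)
    (f : Ω → A) (g : Ω → B) (b : B) :
    ∑ a, pr P (fun ω => (f ω, g ω)) (a, b) = pr P g b := by
  simp only [pr]
  rw [Finset.sum_comm]
  refine Finset.sum_congr rfl fun ω _ => ?_
  by_cases h : g ω = b <;> simp [Prod.mk.injEq, h]

lemma pr_prodMk_le {Ω A B : Type*} [Fintype Ω] [Fintype A] {P : Ω → ℝ} (hP : ∀ ω, 0 ≤ P ω)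
    (f : Ω → A) (g : Ω → B) (a : A) (b : B) :
    pr P (fun ω => (f ω, g ω)) (a, b) ≤ pr P g b := by
  rw [← sum_pr_prodMk P f g b]
  exact Finset.single_le_sum (f := fun a => pr P (fun ω => (f ω, g ω)) (a, b))
    (fun a _ => pr_nonneg hP _ _) (Finset.mem_univ a)

/-- The negated conditional entropy `-H(f|g)` as a sum of relative-entropy terms. -/
lemma ent_sub_ent_prodMk {Ω A B : Type*} [Fintype Ω] [Fintype A] [Fintype B] (P : Ω → ℝ)
    (f : Ω → A) (g : Ω → B) :
    ent P g - ent P (fun ω => (f ω, g ω)) =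
      ∑ b, ∑ a, pr P (fun ω => (f ω, g ω)) (a, b) *
        (Real.log (pr P (fun ω => (f ω, g ω)) (a, b)) - Real.log (pr P g b)) := by
  simp only [ent, Fintype.sum_prod_type_right, mul_sub, Finset.sum_sub_distrib,
    ← Finset.sum_mul, sum_pr_prodMk]
  ring

/-- Tangent-plane inequality for `(x, y) ↦ x log (x / y)` at the point `(a, b)`. -/
lemma tangent_le_mul_log_sub_log {a b x y : ℝ} (ha : 0 < a) (hb : 0 < b) (hx : 0 ≤ x)
    (hxy : x ≤ y) :
    x * (Real.log a - Real.log b) + x - y * (a / b) ≤ x * (Real.log x - Real.log y) := by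
  rcases hx.eq_or_lt with rfl | hx
  · have : 0 ≤ y * (a / b) := by positivity
    simpa using this
  · have hy : 0 < y := hx.trans_le hxy
    have h := Real.log_le_sub_one_of_pos (show 0 < y * a / (x * b) by positivity)
    rw [Real.log_div (by positivity) (by positivity), Real.log_mul hy.ne' ha.ne',
      Real.log_mul hx.ne' hb.ne'] at h
    have h2 := mul_le_mul_of_nonneg_left h hx.le
    have h3 : x * (y * a / (x * b) - 1) = y * (a / b) - x := by field_simp
    rw [h3] at h2
    linarith

/-- Two-term log-sum inequality. -/
lemma mul_log_sub_log_combination_le {x₁ y₁ x₂ y₂ s t : ℝ} (hx₁ : 0 ≤ x₁) (hxy₁ : x₁ ≤ y₁)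
    (hx₂ : 0 ≤ x₂) (hxy₂ : x₂ ≤ y₂) (hs : 0 ≤ s) (ht : 0 ≤ t) :
    (s * x₁ + t * x₂) * (Real.log (s * x₁ + t * x₂) - Real.log (s * y₁ + t * y₂)) ≤
      s * (x₁ * (Real.log x₁ - Real.log y₁)) + t * (x₂ * (Real.log x₂ - Real.log y₂)) := by
  have h₁ : 0 ≤ s * x₁ := mul_nonneg hs hx₁
  have h₂ : 0 ≤ t * x₂ := mul_nonneg ht hx₂
  rcases (add_nonneg h₁ h₂).eq_or_lt with h | ha
  · have e₁ : s * x₁ = 0 := by linarith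
    have e₂ : t * x₂ = 0 := by linarith
    simp [← mul_assoc, e₁, e₂]
  · have hb : 0 < s * y₁ + t * y₂ := ha.trans_le (by gcongr)
    have k₁ := mul_le_mul_of_nonneg_left (tangent_le_mul_log_sub_log ha hb hx₁ hxy₁) hs
    have k₂ := mul_le_mul_of_nonneg_left (tangent_le_mul_log_sub_log ha hb hx₂ hxy₂) ht
    have e : (s * y₁ + t * y₂) * ((s * x₁ + t * x₂) / (s * y₁ + t * y₂)) = s * x₁ + t * x₂ :=
      mul_div_cancel₀ _ hb.ne'
    linarith

/-- The negated conditional entropy `-H(f|g)` is convex in the joint distribution. -/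
lemma ent_sub_ent_prodMk_combination_le {Ω A B : Type*} [Fintype Ω] [Fintype A] [Fintype B]
    {P Q : Ω → ℝ} (hP : ∀ ω, 0 ≤ P ω) (hQ : ∀ ω, 0 ≤ Q ω) {s t : ℝ} (hs : 0 ≤ s) (ht : 0 ≤ t)
    (f : Ω → A) (g : Ω → B) :
    ent (fun ω => s * P ω + t * Q ω) g - ent (fun ω => s * P ω + t * Q ω) (fun ω => (f ω, g ω)) ≤
      s * (ent P g - ent P (fun ω => (f ω, g ω))) +
        t * (ent Q g - ent Q (fun ω => (f ω, g ω))) := by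
  simp only [ent_sub_ent_prodMk, Finset.mul_sum, ← Finset.sum_add_distrib, pr_combination]
  gcongr with b _ a _
  exact mul_log_sub_log_combination_le (pr_nonneg hP _ _) (pr_prodMk_le hP f g a b)
    (pr_nonneg hQ _ _) (pr_prodMk_le hQ f g a b) hs ht

section jointCC

variable {S1 S2 V1 U X Y : Type*}

lemma jointCC_nonneg {p : S1 → S2 → ℝ} (hp0 : ∀ s1 s2, 0 ≤ p s1 s2)
    {puv : S1 → U → V1 → ℝ} (hpuv0 : ∀ s1 u v1, 0 ≤ puv s1 u v1)
    {ch : X → S1 → S2 → Y → ℝ} (hch0 : ∀ x s1 s2 y, 0 ≤ ch x s1 s2 y)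
    {π : U → S1 → V1 → X → ℝ} (hπ0 : ∀ u s1 v1 x, 0 ≤ π u s1 v1 x)
    (ω : S1 × S2 × V1 × U × X × Y) : 0 ≤ jointCC p puv ch π ω :=
  mul_nonneg (mul_nonneg (mul_nonneg (hp0 _ _) (hpuv0 _ _ _)) (hπ0 _ _ _ _)) (hch0 _ _ _ _)

lemma jointCC_combination (p : S1 → S2 → ℝ) (puv : S1 → U → V1 → ℝ) (ch : X → S1 → S2 → Y → ℝ)
    (π ρ : U → S1 → V1 → X → ℝ) (s t : ℝ) :
    jointCC p puv ch (s • π + t • ρ) =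
      fun ω => s * jointCC p puv ch π ω + t * jointCC p puv ch ρ ω := by
  funext ω
  simp only [jointCC, Pi.add_apply, Pi.smul_apply, smul_eq_mul]
  ring

variable [Fintype S1] [Fintype S2] [Fintype V1] [Fintype U] [Fintype X] [Fintype Y]

/-- The law of a function of `(S₁,S₂,V₁,U)` does not depend on `π`. -/
lemma pr_jointCC {A : Type*} (p : S1 → S2 → ℝ) (puv : S1 → U → V1 → ℝ)
    {ch : X → S1 → S2 → Y → ℝ} (hch1 : ∀ x s1 s2, ∑ y, ch x s1 s2 y = 1)
    {π : U → S1 → V1 → X → ℝ} (hπ1 : ∀ u s1 v1, ∑ x, π u s1 v1 x = 1)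
    (f : S1 → S2 → V1 → U → A) (a : A) :
    pr (jointCC p puv ch π) (fun ω => f ω.1 ω.2.1 ω.2.2.1 ω.2.2.2.1) a =
      ∑ s1, ∑ s2, ∑ v1, ∑ u, if f s1 s2 v1 u = a then p s1 s2 * puv s1 u v1 else 0 := by
  simp only [pr, jointCC, Fintype.sum_prod_type]
  refine Finset.sum_congr rfl fun s1 _ => Finset.sum_congr rfl fun s2 _ =>
    Finset.sum_congr rfl fun v1 _ => Finset.sum_congr rfl fun u _ => ?_
  split_ifs
  · simp only [← Finset.mul_sum, hch1, hπ1, mul_one]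
  · simp

lemma ent_jointCC_congr {A : Type*} [Fintype A] (p : S1 → S2 → ℝ) (puv : S1 → U → V1 → ℝ)
    {ch : X → S1 → S2 → Y → ℝ} (hch1 : ∀ x s1 s2, ∑ y, ch x s1 s2 y = 1)
    {π ρ : U → S1 → V1 → X → ℝ} (hπ1 : ∀ u s1 v1, ∑ x, π u s1 v1 x = 1)
    (hρ1 : ∀ u s1 v1, ∑ x, ρ u s1 v1 x = 1) (f : S1 → S2 → V1 → U → A) :
    ent (jointCC p puv ch π) (fun ω => f ω.1 ω.2.1 ω.2.2.1 ω.2.2.2.1) =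
      ent (jointCC p puv ch ρ) (fun ω => f ω.1 ω.2.1 ω.2.2.1 ω.2.2.2.1) := by
  simp only [ent, pr_jointCC p puv hch1 hπ1 f, pr_jointCC p puv hch1 hρ1 f]

/-- Up to a term not depending on `π`, `F(π)` is the negated conditional entropy
`-H(U|Y,S₂,V₁)`. -/
lemma Fcc_sub_Fcc (p : S1 → S2 → ℝ) (puv : S1 → U → V1 → ℝ)
    {ch : X → S1 → S2 → Y → ℝ} (hch1 : ∀ x s1 s2, ∑ y, ch x s1 s2 y = 1)
    {π ρ : U → S1 → V1 → X → ℝ} (hπ1 : ∀ u s1 v1, ∑ x, π u s1 v1 x = 1)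
    (hρ1 : ∀ u s1 v1, ∑ x, ρ u s1 v1 x = 1) :
    Fcc p puv ch π - Fcc p puv ch ρ =
      (ent (jointCC p puv ch π) (fun ω => ((ω.2.2.2.2.2, ω.2.1), ω.2.2.1)) -
        ent (jointCC p puv ch π) (fun ω => (ω.2.2.2.1, ((ω.2.2.2.2.2, ω.2.1), ω.2.2.1)))) -
      (ent (jointCC p puv ch ρ) (fun ω => ((ω.2.2.2.2.2, ω.2.1), ω.2.2.1)) -
        ent (jointCC p puv ch ρ) (fun ω => (ω.2.2.2.1, ((ω.2.2.2.2.2, ω.2.1), ω.2.2.1)))) := by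
  have h₁ := ent_jointCC_congr p puv hch1 hπ1 hρ1 fun _ _ v1 u => (u, v1)
  have h₂ := ent_jointCC_congr p puv hch1 hπ1 hρ1 fun _ _ v1 _ => v1
  have h₃ := ent_jointCC_congr p puv hch1 hπ1 hρ1 fun s1 _ v1 _ => (s1, v1)
  have h₄ := ent_jointCC_congr p puv hch1 hπ1 hρ1 fun s1 _ v1 u => (u, s1, v1)
  simp only [Fcc, cmi]
  linarith

end jointCC

/-- for a fixed conditional pmf `p(u,v₁|s₁)`, the function
`F(π) = I(U;Y,S₂|V₁) − I(U;S₁|V₁)` is a convex function of the conditional pmf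
`π(x|u,s₁,v₁)` on the convex set of conditional pmfs. -/
theorem Fcc_convex {S1 S2 V1 U X Y : Type*}
    [Fintype S1] [Fintype S2] [Fintype V1] [Fintype U] [Fintype X] [Fintype Y]
    [Nonempty S1] [Nonempty S2] [Nonempty V1] [Nonempty U] [Nonempty X] [Nonempty Y]
    (p : S1 → S2 → ℝ) (hp0 : ∀ s1 s2, 0 ≤ p s1 s2) (hp1 : ∑ s1, ∑ s2, p s1 s2 = 1)
    (puv : S1 → U → V1 → ℝ) (hpuv0 : ∀ s1 u v1, 0 ≤ puv s1 u v1)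
    (hpuv1 : ∀ s1, ∑ u, ∑ v1, puv s1 u v1 = 1)
    (ch : X → S1 → S2 → Y → ℝ) (hch0 : ∀ x s1 s2 y, 0 ≤ ch x s1 s2 y)
    (hch1 : ∀ x s1 s2, ∑ y, ch x s1 s2 y = 1) :
    ConvexOn ℝ
      {π : U → S1 → V1 → X → ℝ |
        (∀ u s1 v1 x, 0 ≤ π u s1 v1 x) ∧ ∀ u s1 v1, ∑ x, π u s1 v1 x = 1}
      (fun π => Fcc p puv ch π) := by
  have hconv : Convex ℝ {π : U → S1 → V1 → X → ℝ |
      (∀ u s1 v1 x, 0 ≤ π u s1 v1 x) ∧ ∀ u s1 v1, ∑ x, π u s1 v1 x = 1} := by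
    rintro π ⟨hπ0, hπ1⟩ ρ ⟨hρ0, hρ1⟩ s t hs ht hst
    refine ⟨fun u s1 v1 x => ?_, fun u s1 v1 => ?_⟩
    · exact add_nonneg (mul_nonneg hs (hπ0 u s1 v1 x)) (mul_nonneg ht (hρ0 u s1 v1 x))
    · simp [Finset.sum_add_distrib, ← Finset.mul_sum, hπ1, hρ1, hst]
  refine ⟨hconv, fun π hπ ρ hρ s t hs ht hst => ?_⟩
  have hσ := hconv hπ hρ hs ht hst
  have h := ent_sub_ent_prodMk_combination_le (jointCC_nonneg hp0 hpuv0 hch0 hπ.1)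
    (jointCC_nonneg hp0 hpuv0 hch0 hρ.1) hs ht (fun ω => ω.2.2.2.1)
    (fun ω => ((ω.2.2.2.2.2, ω.2.1), ω.2.2.1))
  rw [← jointCC_combination] at h
  have hσπ := Fcc_sub_Fcc p puv hch1 hσ.2 hπ.2
  have hρπ := Fcc_sub_Fcc p puv hch1 hρ.2 hπ.2
  obtain rfl : s = 1 - t := by linarith
  simp only [smul_eq_mul]
  linear_combination h + hσπ - t * hρπ
end

section
/- Single-letterization in the Wyner–Ziv converse (dual to the Gelfand–Pinsker converse): let n be a positive integer and let T, X₁,...,Xₙ, S₁,...,Sₙ be random variables with values in finite sets such that for each i ∈ {1,...,n}, Sᵢ is independent of S_{i+1}^n = (S_{i+1},...,Sₙ) and Xᵢ is independent of X^{i−1} = (X₁,...,X_{i−1}). Then I(T; X^n) − I(T; S^n) ≥ Σ_{i=1}^n [ I(Uᵢ; Xᵢ) − I(Uᵢ; Sᵢ) ], where Uᵢ = (T, X^{i−1}, S_{i+1}^n). -/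
open scoped Classical

/-- The prefix tuple `A^{i-1} = (A₁, …, A_{i−1})` of a finite sequence of random
variables (as a single random variable). -/
def pre {Ω A : Type*} {n : ℕ} (f : Fin n → Ω → A) (i : Fin n) :
    Ω → (Fin i.val → A) :=
  fun ω j => f ⟨j.val, j.isLt.trans i.isLt⟩ ω

/-- The suffix tuple `A_{i+1}^n = (A_{i+1}, …, A_n)` of a finite sequence of random
variables (as a single random variable). -/
def suf {Ω A : Type*} {n : ℕ} (f : Fin n → Ω → A) (i : Fin n) :
    Ω → (Fin (n - (i.val + 1)) → A) :=
  fun ω j => f ⟨i.val + 1 + j.val, by have h1 := j.isLt; have h2 := i.isLt; omega⟩ ω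

/-- Independence of two random variables on a finite pmf space. -/
def IndepRV {Ω A B : Type*} [Fintype Ω]
    (P : Ω → ℝ) (f : Ω → A) (g : Ω → B) : Prop :=
  ∀ a b, pr P (fun ω => (f ω, g ω)) (a, b) = pr P f a * pr P g b

/-- Conditional independence of `f` and `g` given `h` on a finite pmf space. -/
def CondIndepRV {Ω A B C : Type*} [Fintype Ω]
    (P : Ω → ℝ) (f : Ω → A) (g : Ω → B) (h : Ω → C) : Prop :=
  ∀ a b c,
    pr P (fun ω => (f ω, g ω, h ω)) (a, b, c) * pr P h c =
      pr P (fun ω => (f ω, h ω)) (a, c) * pr P (fun ω => (g ω, h ω)) (b, c)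

theorem le_pr_apply {Ω A : Type*} [Fintype Ω] {P : Ω → ℝ} (hP : ∀ ω, 0 ≤ P ω)
    (f : Ω → A) (ω : Ω) : P ω ≤ pr P f (f ω) := by
  have h := Finset.single_le_sum (f := fun ω' => if f ω' = f ω then P ω' else 0)
    (fun ω' _ => by split_ifs <;> simp [hP]) (Finset.mem_univ ω)
  simpa [pr] using h

/-- Entropy as the expectation of the negative log-likelihood. -/
theorem ent_eq_neg_sum {Ω A : Type*} [Fintype Ω] [Fintype A] (P : Ω → ℝ) (f : Ω → A) :
    ent P f = -∑ ω, P ω * Real.log (pr P f (f ω)) := by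
  have h : ∀ a, pr P f a * Real.log (pr P f a) =
      ∑ ω, if f ω = a then P ω * Real.log (pr P f a) else 0 := by
    intro a
    conv_lhs => rw [pr, Finset.sum_mul]
    exact Finset.sum_congr rfl fun ω _ => by rw [ite_mul, zero_mul, ← pr]
  rw [ent, Finset.sum_congr rfl fun a _ => h a, Finset.sum_comm]
  simp

/-- Entropy depends only on the partition of the sample space into level sets. -/
theorem ent_congr {Ω A B : Type*} [Fintype Ω] [Fintype A] [Fintype B] (P : Ω → ℝ)
    (f : Ω → A) (g : Ω → B) (h : ∀ ω ω', f ω = f ω' ↔ g ω = g ω') : ent P f = ent P g := by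
  simp only [ent_eq_neg_sum, pr, h]

theorem ent_eq_zero_of_const {Ω A : Type*} [Fintype Ω] [Fintype A] {P : Ω → ℝ}
    (hP1 : ∑ ω, P ω = 1) (f : Ω → A) (h : ∀ ω ω', f ω = f ω') : ent P f = 0 := by
  have h1 : ∀ ω, pr P f (f ω) = 1 := fun ω => by simp [pr, h _ ω, hP1]
  simp [ent_eq_neg_sum, h1]

theorem ent_prod_of_indep {Ω A B : Type*} [Fintype Ω] [Fintype A] [Fintype B] {P : Ω → ℝ}
    (hP : ∀ ω, 0 ≤ P ω) (f : Ω → A) (g : Ω → B) (h : IndepRV P f g) :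
    ent P (fun ω => (f ω, g ω)) = ent P f + ent P g := by
  rw [ent_eq_neg_sum, ent_eq_neg_sum, ent_eq_neg_sum, ← neg_add, ← Finset.sum_add_distrib]
  refine congrArg _ (Finset.sum_congr rfl fun ω _ => ?_)
  rcases (hP ω).eq_or_lt with h0 | h0
  · simp [← h0]
  · rw [h, Real.log_mul (h0.trans_le (le_pr_apply hP f ω)).ne'
      (h0.trans_le (le_pr_apply hP g ω)).ne', mul_add]

theorem pre_eq_iff {Ω A : Type*} {n : ℕ} (f : Fin n → Ω → A) (i : Fin n) (ω ω' : Ω) :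
    pre f i ω = pre f i ω' ↔ ∀ j < i, f j ω = f j ω' := by
  simp only [funext_iff, pre]
  exact ⟨fun h j hj => h ⟨j, hj⟩, fun h j => h _ j.isLt⟩

theorem suf_eq_iff {Ω A : Type*} {n : ℕ} (f : Fin n → Ω → A) (i : Fin n) (ω ω' : Ω) :
    suf f i ω = suf f i ω' ↔ ∀ j, i < j → f j ω = f j ω' := by
  simp only [funext_iff, suf]
  refine ⟨fun h j hj => ?_, fun h j => h _ ?_⟩
  · have hj' : i.val < j.val := hj
    have := h ⟨j.val - (i.val + 1), by omega⟩
    have e : i.val + 1 + (j.val - (i.val + 1)) = j.val := by omega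
    simpa only [e] using this
  · rw [Fin.lt_def]
    simp only
    omega

/-- The hybrid sequence `(A₁, …, A_k, B_{k+1}, …, B_n)`. -/
def hybrid {Ω A B : Type*} {n : ℕ} (f : Fin n → Ω → A) (g : Fin n → Ω → B) (k : ℕ) :
    Ω → Fin n → A ⊕ B :=
  fun ω j => if j.val < k then Sum.inl (f j ω) else Sum.inr (g j ω)

theorem hybrid_eq_iff {Ω A B : Type*} {n : ℕ} (f : Fin n → Ω → A) (g : Fin n → Ω → B) (k : ℕ)
    (ω ω' : Ω) : hybrid f g k ω = hybrid f g k ω' ↔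
      (∀ j : Fin n, j.val < k → f j ω = f j ω') ∧ ∀ j : Fin n, k ≤ j.val → g j ω = g j ω' := by
  simp only [funext_iff, hybrid, ← forall_and]
  refine forall_congr' fun j => ?_
  by_cases hj : j.val < k
  · simp [hj]
  · simp [hj, not_lt.mp hj]

theorem hybrid_zero_eq_iff {Ω A B : Type*} {n : ℕ} (f : Fin n → Ω → A) (g : Fin n → Ω → B)
    (ω ω' : Ω) : hybrid f g 0 ω = hybrid f g 0 ω' ↔ (fun i => g i ω) = fun i => g i ω' := by
  rw [hybrid_eq_iff, funext_iff]
  simp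

theorem hybrid_self_eq_iff {Ω A B : Type*} {n : ℕ} (f : Fin n → Ω → A) (g : Fin n → Ω → B)
    (ω ω' : Ω) : hybrid f g n ω = hybrid f g n ω' ↔ (fun i => f i ω) = fun i => f i ω' := by
  rw [hybrid_eq_iff, funext_iff]
  refine ⟨fun h j => h.1 j j.isLt, fun h => ⟨fun j _ => h j, fun j hj => ?_⟩⟩
  exact absurd j.isLt hj.not_gt

theorem sum_fin_sub {n : ℕ} (F : ℕ → ℝ) :
    ∑ i : Fin n, (F (i.val + 1) - F i.val) = F n - F 0 := by
  rw [Fin.sum_univ_eq_sum_range (fun i => F (i + 1) - F i), Finset.sum_range_sub]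

theorem forall_val_lt_succ_iff {n : ℕ} (i : Fin n) (p : Fin n → Prop) :
    (∀ j : Fin n, j.val < i.val + 1 → p j) ↔ p i ∧ ∀ j < i, p j := by
  refine ⟨fun h => ⟨h i (by omega), fun j hj => h j (Nat.lt_succ_of_lt hj)⟩, fun h j hj => ?_⟩
  rcases (Nat.lt_succ_iff.mp hj).eq_or_lt with e | e
  · exact Fin.ext e ▸ h.1
  · exact h.2 j e

theorem forall_val_le_iff {n : ℕ} (i : Fin n) (p : Fin n → Prop) :
    (∀ j : Fin n, i.val ≤ j.val → p j) ↔ p i ∧ ∀ j, i < j → p j := by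
  refine ⟨fun h => ⟨h i le_rfl, fun j hj => h j (le_of_lt hj)⟩, fun h j hj => ?_⟩
  rcases hj.eq_or_lt with e | e
  · exact Fin.ext e ▸ h.1
  · exact h.2 j e

theorem ent_eq_sum_of_indep_pre {Ω A : Type*} [Fintype Ω] [Fintype A] {n : ℕ} {P : Ω → ℝ}
    (hP0 : ∀ ω, 0 ≤ P ω) (hP1 : ∑ ω, P ω = 1) (f : Fin n → Ω → A)
    (h : ∀ i, IndepRV P (f i) (pre f i)) :
    ent P (fun ω i => f i ω) = ∑ i, ent P (f i) := by
  let F : ℕ → ℝ := fun k => ent P (hybrid f (fun _ _ => ()) k)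
  have hF : ∀ i : Fin n, ent P (f i) = F (i.val + 1) - F i.val := by
    intro i
    have h1 : F (i.val + 1) = ent P (fun ω => (f i ω, pre f i ω)) :=
      ent_congr _ _ _ fun ω ω' => by
        simp only [Prod.mk.injEq, hybrid_eq_iff, pre_eq_iff, forall_val_lt_succ_iff,
          implies_true, and_true]
    have h2 : F i.val = ent P (pre f i) :=
      ent_congr _ _ _ fun ω ω' => by simp [hybrid_eq_iff, pre_eq_iff]
    rw [h1, h2, ent_prod_of_indep hP0 _ _ (h i), add_sub_cancel_right]
  have h0 : F 0 = 0 :=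
    ent_eq_zero_of_const hP1 _ fun ω ω' => (hybrid_zero_eq_iff _ _ ω ω').2 rfl
  have hn : F n = ent P (fun ω i => f i ω) := ent_congr _ _ _ (hybrid_self_eq_iff _ _)
  rw [Finset.sum_congr rfl fun i _ => hF i, sum_fin_sub, h0, hn, sub_zero]

theorem ent_eq_sum_of_indep_suf {Ω A : Type*} [Fintype Ω] [Fintype A] {n : ℕ} {P : Ω → ℝ}
    (hP0 : ∀ ω, 0 ≤ P ω) (hP1 : ∑ ω, P ω = 1) (f : Fin n → Ω → A)
    (h : ∀ i, IndepRV P (f i) (suf f i)) :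
    ent P (fun ω i => f i ω) = ∑ i, ent P (f i) := by
  let F : ℕ → ℝ := fun k => ent P (hybrid (fun _ _ => ()) f k)
  have hF : ∀ i : Fin n, ent P (f i) = -(F (i.val + 1) - F i.val) := by
    intro i
    have h1 : F i.val = ent P (fun ω => (f i ω, suf f i ω)) :=
      ent_congr _ _ _ fun ω ω' => by
        simp only [Prod.mk.injEq, hybrid_eq_iff, suf_eq_iff, forall_val_le_iff,
          implies_true, true_and]
    have h2 : F (i.val + 1) = ent P (suf f i) :=
      ent_congr _ _ _ fun ω ω' => by simp [hybrid_eq_iff, suf_eq_iff]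
    rw [h1, h2, ent_prod_of_indep hP0 _ _ (h i)]
    ring
  have h0 : F 0 = ent P (fun ω i => f i ω) := ent_congr _ _ _ (hybrid_zero_eq_iff _ _)
  have hn : F n = 0 :=
    ent_eq_zero_of_const hP1 _ fun ω ω' => (hybrid_self_eq_iff _ _ ω ω').2 rfl
  rw [Finset.sum_congr rfl fun i _ => hF i, Finset.sum_neg_distrib, sum_fin_sub, h0, hn]
  ring

/-- single-letterization in the Wyner–Ziv converse (dual to the
Gelfand–Pinsker converse).  If each `Sᵢ` is independent of the suffix `S_{i+1}^n` and
each `Xᵢ` is independent of the prefix `X^{i−1}`, then, with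
`Uᵢ = (T, X^{i−1}, S_{i+1}^n)`,
`I(T;X^n) − I(T;S^n) ≥ Σᵢ [ I(Uᵢ;Xᵢ) − I(Uᵢ;Sᵢ) ]`. -/
theorem WZ_single_letterization {Ω Tt Xt St : Type*}
    [Fintype Ω] [Fintype Tt] [Fintype Xt] [Fintype St]
    {n : ℕ} (hn : 0 < n)
    (P : Ω → ℝ) (hP0 : ∀ ω, 0 ≤ P ω) (hP1 : ∑ ω, P ω = 1)
    (T : Ω → Tt) (X : Fin n → Ω → Xt) (S : Fin n → Ω → St)
    (hindS : ∀ i : Fin n, IndepRV P (S i) (suf S i))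
    (hindX : ∀ i : Fin n, IndepRV P (X i) (pre X i)) :
    ∑ i : Fin n,
        (mi P (fun ω => (T ω, pre X i ω, suf S i ω)) (X i) -
          mi P (fun ω => (T ω, pre X i ω, suf S i ω)) (S i)) ≤
      mi P T (fun ω => fun i => X i ω) - mi P T (fun ω => fun i => S i ω) := by
  let F : ℕ → ℝ := fun k => ent P (fun ω => (T ω, hybrid X S k ω))
  have hF : ∀ i : Fin n,
      mi P (fun ω => (T ω, pre X i ω, suf S i ω)) (X i) -
          mi P (fun ω => (T ω, pre X i ω, suf S i ω)) (S i) =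
        ent P (X i) - ent P (S i) - (F (i.val + 1) - F i.val) := by
    intro i
    have h1 : F (i.val + 1) = ent P (fun ω => ((T ω, pre X i ω, suf S i ω), X i ω)) :=
      ent_congr _ _ _ fun ω ω' => by
        simp only [Prod.mk.injEq, hybrid_eq_iff, pre_eq_iff, suf_eq_iff, forall_val_lt_succ_iff,
          Nat.succ_le_iff, Fin.val_fin_lt]
        tauto
    have h2 : F i.val = ent P (fun ω => ((T ω, pre X i ω, suf S i ω), S i ω)) :=
      ent_congr _ _ _ fun ω ω' => by
        simp only [Prod.mk.injEq, hybrid_eq_iff, pre_eq_iff, suf_eq_iff, forall_val_le_iff,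
          Fin.val_fin_lt]
        tauto
    rw [h1, h2, mi, mi]
    ring
  have h0 : F 0 = ent P (fun ω => (T ω, fun i => S i ω)) :=
    ent_congr _ _ _ fun ω ω' => by simp only [Prod.mk.injEq, hybrid_zero_eq_iff]
  have hn' : F n = ent P (fun ω => (T ω, fun i => X i ω)) :=
    ent_congr _ _ _ fun ω ω' => by simp only [Prod.mk.injEq, hybrid_self_eq_iff]
  rw [Finset.sum_congr rfl fun i _ => hF i, Finset.sum_sub_distrib, Finset.sum_sub_distrib,
    sum_fin_sub, h0, hn', mi, mi, ent_eq_sum_of_indep_pre hP0 hP1 X hindX,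
    ent_eq_sum_of_indep_suf hP0 hP1 S hindS]
  linarith
end
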